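/- Variational characterization of the ground state energy: E^c(W) = inf { E^c(f) : f : ℝ³ → ℂ continuously differentiable, f ∈ L⁶(ℝ³), ∇f ∈ L²(ℝ³), ‖∇f‖_{L²} = ‖∇W‖_{L²} }, and the infimum is attained at f = W. -/

import Mathlib

open MeasureTheory Complex
open scoped BigOperators ENNReal

noncomputable section

abbrev E3 := EuclideanSpace ℝ (Fin 3)

/-- The Aubin–Talenti ground state `W(x) = (1 + |x|²/3)^(-1/2)`. -/
def W (x : E3) : ℝ := (1 + ‖x‖ ^ 2 / 3) ^ (-(1 : ℝ) / 2)

/-- `W` viewed as a complex-valued function. -/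
def Wc (x : E3) : ℂ := (W x : ℂ)

/-- Standard basis vectors of ℝ³. -/
def e3 (i : Fin 3) : E3 := EuclideanSpace.single i 1

/-- Partial derivative of a real-valued function. -/
def pdR (i : Fin 3) (f : E3 → ℝ) (x : E3) : ℝ := fderiv ℝ f x (e3 i)

/-- Partial derivative of a complex-valued function. -/
def pdC (i : Fin 3) (f : E3 → ℂ) (x : E3) : ℂ := fderiv ℝ f x (e3 i)

/-- Squared gradient `|∇f|²` of a real-valued function. -/
def gradSqR (f : E3 → ℝ) (x : E3) : ℝ := ∑ i, (pdR i f x) ^ 2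

/-- Squared gradient `|∇f|²` of a complex-valued function. -/
def gradSqC (f : E3 → ℂ) (x : E3) : ℝ := ∑ i, ‖pdC i f x‖ ^ 2

/-- Laplacian of a real-valued function. -/
def lapR (f : E3 → ℝ) (x : E3) : ℝ := ∑ i, pdR i (pdR i f) x

/-- Laplacian of a complex-valued function. -/
def lapC (f : E3 → ℂ) (x : E3) : ℂ := ∑ i, pdC i (pdC i f) x

/-- Quintic (energy-critical) energy `E^c`. -/
def Ecrit (f : E3 → ℂ) : ℝ := ∫ x : E3, ((1:ℝ)/2 * gradSqC f x - 1/6 * ‖f x‖ ^ 6)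

/-- Cubic–quintic energy `E`. -/
def Ecq (f : E3 → ℂ) : ℝ :=
  ∫ x : E3, ((1:ℝ)/2 * gradSqC f x - 1/6 * ‖f x‖ ^ 6 + 1/4 * ‖f x‖ ^ 4)

/-- Regular solutions of the cubic–quintic NLS on an interval `I ⊆ ℝ`. -/
def IsRegularSolution (I : Set ℝ) (u : ℝ → E3 → ℂ) : Prop :=
  ContDiffOn ℝ (⊤ : ℕ∞) (fun p : ℝ × E3 => u p.1 p.2) (I ×ˢ Set.univ) ∧
  (∀ t ∈ I, ∀ x : E3, Complex.I * deriv (fun s => u s x) t + lapC (u t) x =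
      (‖u t x‖ : ℂ) ^ 2 * u t x - (‖u t x‖ : ℂ) ^ 4 * u t x) ∧
  (∀ J : Set ℝ, IsCompact J → J ⊆ I → ∀ n k : ℕ, ∃ C : ℝ, ∀ t ∈ J, ∀ x : E3,
      (1 + ‖x‖) ^ n * ‖iteratedFDeriv ℝ k (u t) x‖ ≤ C)


section

open Set Filter Topology

lemma hasDerivAt_integral_Iic {q : ℝ → ℝ} (hc : Continuous q) (hi : Integrable q) (y : ℝ) :
    HasDerivAt (fun y => ∫ t in Iic y, q t) (q y) y := by
  have h : (fun y => ∫ t in Iic y, q t) = fun y => (∫ t in Iic 0, q t) + ∫ t in (0 : ℝ)..y, q t := by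
    ext y
    rw [← intervalIntegral.integral_Iic_sub_Iic hi.integrableOn hi.integrableOn]
    ring
  rw [h]
  exact (intervalIntegral.integral_hasDerivAt_right (hc.intervalIntegrable _ _)
    (hc.stronglyMeasurableAtFilter _ _) hc.continuousAt).const_add _

lemma strictMono_integral_Iic {q : ℝ → ℝ} (hc : Continuous q) (hi : Integrable q)
    (hpos : ∀ x, 0 < q x) : StrictMono fun y => ∫ t in Iic y, q t := by
  refine strictMono_of_deriv_pos fun x => ?_
  rw [(hasDerivAt_integral_Iic hc hi x).deriv]
  exact hpos x

lemma tendsto_integral_Iic_atTop {q : ℝ → ℝ} (hi : Integrable q) :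
    Tendsto (fun y => ∫ t in Iic y, q t) atTop (𝓝 (∫ t, q t)) :=
  (aecover_Iic tendsto_id).integral_tendsto_of_countably_generated hi

lemma tendsto_integral_Iic_atBot {q : ℝ → ℝ} (hi : Integrable q) :
    Tendsto (fun y => ∫ t in Iic y, q t) atBot (𝓝 0) := by
  have h1 : Tendsto (fun y => ∫ t in Ioi y, q t) atBot (𝓝 (∫ t, q t)) :=
    (aecover_Ioi tendsto_id).integral_tendsto_of_countably_generated hi
  have h2 : (fun y => ∫ t in Iic y, q t) = fun y => (∫ t, q t) - ∫ t in Ioi y, q t := by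
    ext y
    rw [← intervalIntegral.integral_Iic_add_Ioi (b := y) hi.integrableOn hi.integrableOn]
    ring
  rw [h2]
  simpa using h1.const_sub (∫ t, q t)

lemma integral_Iic_mem_Ioo {p : ℝ → ℝ} (hc : Continuous p) (hi : Integrable p)
    (hpos : ∀ x, 0 < p x) (x : ℝ) : ∫ t in Iic x, p t ∈ Ioo 0 (∫ t, p t) := by
  have hm := strictMono_integral_Iic hc hi hpos
  constructor
  · refine lt_of_le_of_lt ?_ (hm (sub_one_lt x))
    exact hm.monotone.le_of_tendsto (tendsto_integral_Iic_atBot hi) _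
  · refine lt_of_lt_of_le (hm (lt_add_one x)) ?_
    exact hm.monotone.ge_of_tendsto (tendsto_integral_Iic_atTop hi) _

lemma exists_integral_Iic_eq {q : ℝ → ℝ} (hc : Continuous q) (hi : Integrable q)
    {c : ℝ} (hx : c ∈ Ioo 0 (∫ t, q t)) : ∃ y, ∫ t in Iic y, q t = c := by
  have hcont : Continuous fun y => ∫ t in Iic y, q t :=
    continuous_iff_continuousAt.2 fun y => (hasDerivAt_integral_Iic hc hi y).continuousAt
  exact mem_range_of_exists_le_of_exists_ge hcont
    ((tendsto_integral_Iic_atBot hi).eventually (eventually_le_nhds hx.1)).exists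
    ((tendsto_integral_Iic_atTop hi).eventually (eventually_ge_nhds hx.2)).exists

/-- A map matching the distribution functions of two positive continuous densities of equal mass is
differentiable, and solves the one-dimensional Monge–Ampère equation. -/
lemma hasDerivAt_transport {p q : ℝ → ℝ} (hpc : Continuous p) (hpi : Integrable p)
    (hp : ∀ x, 0 < p x) (hqc : Continuous q) (hqi : Integrable q) (hq : ∀ x, 0 < q x)
    (hpq : ∫ t, p t = ∫ t, q t) {T : ℝ → ℝ}
    (hT : ∀ x, ∫ t in Iic (T x), q t = ∫ t in Iic x, p t) (x : ℝ) :
    HasDerivAt T (p x / q (T x)) x := by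
  have hPm := strictMono_integral_Iic hpc hpi hp
  have hQm := strictMono_integral_Iic hqc hqi hq
  have hTm : StrictMono T := fun a b hab => by
    rw [← hQm.lt_iff_lt]
    simp only [hT]
    exact hPm hab
  have hTs : Function.Surjective T := fun y => by
    obtain ⟨z, hz⟩ := exists_integral_Iic_eq hpc hpi
      (hpq ▸ integral_Iic_mem_Ioo hqc hqi hq y)
    exact ⟨z, hQm.injective (by simp only [hT, hz])⟩
  have hTc : Continuous T := hTm.monotone.continuous_of_surjective hTs
  have hQ := hasDerivAt_integral_Iic hqc hqi (T x)
  have hP := hasDerivAt_integral_Iic hpc hpi x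
  rw [hasDerivAt_iff_tendsto_slope] at hQ hP ⊢
  have hTt : Tendsto T (𝓝[≠] x) (𝓝[≠] (T x)) :=
    hTc.continuousAt.continuousWithinAt.tendsto_nhdsWithin
      fun z hz => hTm.injective.ne hz
  refine (hP.div (hQ.comp hTt) (hq _).ne').congr' ?_
  filter_upwards [self_mem_nhdsWithin] with z hz
  have h1 : z - x ≠ 0 := sub_ne_zero.2 hz
  have h2 : T z - T x ≠ 0 := sub_ne_zero.2 (hTm.injective.ne hz)
  have h3 : (∫ t in Iic z, p t) - ∫ t in Iic x, p t ≠ 0 :=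
    sub_ne_zero.2 (hPm.injective.ne hz)
  simp only [Pi.div_apply, Function.comp_apply, slope_def_field, hT]
  field_simp

lemma lintegral_transport {p q : ℝ → ℝ} (hpc : Continuous p) (hpi : Integrable p)
    (hp : ∀ x, 0 < p x) (hqc : Continuous q) (hqi : Integrable q) (hq : ∀ x, 0 < q x)
    (hpq : ∫ t, p t = ∫ t, q t) {T : ℝ → ℝ}
    (hT : ∀ x, ∫ t in Iic (T x), q t = ∫ t in Iic x, p t) (φ : ℝ → ℝ≥0∞) :
    ∫⁻ x, φ (T x) * ENNReal.ofReal (p x) = ∫⁻ y, φ y * ENNReal.ofReal (q y) := by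
  have hPm := strictMono_integral_Iic hpc hpi hp
  have hQm := strictMono_integral_Iic hqc hqi hq
  have hTi : Function.Injective T := fun a b hab => hPm.injective (by simp only [← hT, hab])
  have hTs : range T = univ := by
    refine eq_univ_of_forall fun y => ?_
    obtain ⟨z, hz⟩ := exists_integral_Iic_eq hpc hpi
      (hpq ▸ integral_Iic_mem_Ioo hqc hqi hq y)
    exact ⟨z, hQm.injective (by simp only [hT, hz])⟩
  have h := lintegral_image_eq_lintegral_abs_deriv_mul (s := univ) (f := T)
    (f' := fun x => p x / q (T x)) MeasurableSet.univ
    (fun x _ => (hasDerivAt_transport hpc hpi hp hqc hqi hq hpq hT x).hasDerivWithinAt)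
    hTi.injOn (fun y => φ y * ENNReal.ofReal (q y))
  rw [image_univ, hTs, Measure.restrict_univ] at h
  rw [h]
  refine lintegral_congr fun x => ?_
  rw [abs_of_pos (div_pos (hp _) (hq _)), mul_left_comm, ← ENNReal.ofReal_mul
    (div_pos (hp _) (hq _)).le, div_mul_cancel₀ _ (hq _).ne']

lemma measurable_integral_Iic {α : Type*} [MeasurableSpace α] {F : α → ℝ → ℝ}
    (hF : Measurable (Function.uncurry F)) :
    Measurable fun z : α × ℝ => ∫ t in Iic z.2, F z.1 t := by
  have h : (fun z : α × ℝ => ∫ t in Iic z.2, F z.1 t) =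
      fun z : α × ℝ => ∫ t, {w : (α × ℝ) × ℝ | w.2 ≤ w.1.2}.indicator
        (fun w => F w.1.1 w.2) (z, t) := by
    ext z
    rw [← integral_indicator measurableSet_Iic]
    rfl
  rw [h]
  refine (StronglyMeasurable.integral_prod_right' ?_).measurable
  refine (Measurable.indicator ?_ ?_).stronglyMeasurable
  · exact hF.comp (f := fun w : (α × ℝ) × ℝ => (w.1.1, w.2)) (by fun_prop)
  · exact measurableSet_le (by fun_prop) (by fun_prop)

/-- One step of the Knothe rearrangement: a map `s` transporting the density `F₁` to `G₁` extends by
a fibrewise monotone map to a transport between densities with these marginals. -/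
lemma exists_knothe_step {α β : Type*} [MeasurableSpace α] [MeasurableSpace β]
    {μ : Measure α} {ν : Measure β} [SFinite μ] [SFinite ν] {s : α → β} (hs : Measurable s)
    {F₁ : α → ℝ} {G₁ : β → ℝ} (hF₁m : Measurable F₁) (hG₁m : Measurable G₁)
    (hF₁ : ∀ a, 0 < F₁ a) (hG₁ : ∀ b, 0 < G₁ b)
    (hst : ∀ φ : β → ℝ≥0∞, Measurable φ →
      ∫⁻ a, φ (s a) * ENNReal.ofReal (F₁ a) ∂μ = ∫⁻ b, φ b * ENNReal.ofReal (G₁ b) ∂ν)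
    {F : α → ℝ → ℝ} {G : β → ℝ → ℝ}
    (hFm : Measurable (Function.uncurry F)) (hGm : Measurable (Function.uncurry G))
    (hF : ∀ a x, 0 < F a x) (hG : ∀ b y, 0 < G b y)
    (hFc : ∀ a, Continuous (F a)) (hGc : ∀ b, Continuous (G b))
    (hFi : ∀ a, Integrable (F a)) (hGi : ∀ b, Integrable (G b))
    (hFF : ∀ a, ∫ x, F a x = F₁ a) (hGG : ∀ b, ∫ y, G b y = G₁ b) :
    ∃ τ : α → ℝ → ℝ, Measurable (Function.uncurry τ) ∧
      (∀ a x, HasDerivAt (τ a) (F a x / F₁ a / (G (s a) (τ a x) / G₁ (s a))) x) ∧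
      ∀ φ : β × ℝ → ℝ≥0∞, Measurable φ →
        ∫⁻ z, φ (s z.1, τ z.1 z.2) * ENNReal.ofReal (F z.1 z.2) ∂(μ.prod volume) =
          ∫⁻ z, φ z * ENNReal.ofReal (G z.1 z.2) ∂(ν.prod volume) := by
  have hp : ∀ a x, 0 < F a x / F₁ a := fun a x => div_pos (hF a x) (hF₁ a)
  have hq : ∀ b y, 0 < G b y / G₁ b := fun b y => div_pos (hG b y) (hG₁ b)
  have hpc : ∀ a, Continuous fun x => F a x / F₁ a := fun a => (hFc a).div_const _
  have hqc : ∀ b, Continuous fun y => G b y / G₁ b := fun b => (hGc b).div_const _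
  have hpi : ∀ a, Integrable fun x => F a x / F₁ a := fun a => (hFi a).div_const _
  have hqi : ∀ b, Integrable fun y => G b y / G₁ b := fun b => (hGi b).div_const _
  have hp1 : ∀ a, ∫ x, F a x / F₁ a = 1 := fun a => by
    rw [integral_div, hFF, div_self (hF₁ a).ne']
  have hq1 : ∀ b, ∫ y, G b y / G₁ b = 1 := fun b => by
    rw [integral_div, hGG, div_self (hG₁ b).ne']
  have hpm : Measurable (Function.uncurry fun a x => F a x / F₁ a) :=
    hFm.div (hF₁m.comp measurable_fst)
  have hqm : Measurable (Function.uncurry fun b y => G b y / G₁ b) :=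
    hGm.div (hG₁m.comp measurable_fst)
  have hex : ∀ a x, ∃ y, ∫ t in Iic y, G (s a) t / G₁ (s a) = ∫ t in Iic x, F a t / F₁ a :=
    fun a x => exists_integral_Iic_eq (hqc _) (hqi _) (by
      rw [hq1, ← hp1 a]; exact integral_Iic_mem_Ioo (hpc a) (hpi a) (hp a) x)
  choose τ hτ using hex
  have hτm : Measurable (Function.uncurry τ) := by
    refine measurable_of_Iic fun c => ?_
    have : Function.uncurry τ ⁻¹' Iic c = {z : α × ℝ | ∫ t in Iic z.2, F z.1 t / F₁ z.1 ≤
        ∫ t in Iic c, G (s z.1) t / G₁ (s z.1)} := by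
      ext ⟨a, x⟩
      simp only [mem_preimage, mem_Iic, Function.uncurry, mem_ofPred_eq, ← hτ]
      exact (strictMono_integral_Iic (hqc (s a)) (hqi _) (hq _)).le_iff_le.symm
    rw [this]
    refine measurableSet_le (measurable_integral_Iic hpm) ?_
    exact (measurable_integral_Iic hqm).comp (f := fun z : α × ℝ => (s z.1, c)) (by fun_prop)
  refine ⟨τ, hτm, fun a x => hasDerivAt_transport (hpc a) (hpi a) (hp a) (hqc (s a)) (hqi _) (hq _)
    (by rw [hp1, hq1]) (hτ a) x, fun φ hφ => ?_⟩
  have hlm : Measurable fun z : α × ℝ => φ (s z.1, τ z.1 z.2) * ENNReal.ofReal (F z.1 z.2) :=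
    (hφ.comp ((hs.comp measurable_fst).prodMk hτm)).mul hFm.ennreal_ofReal
  have hrm : Measurable fun z : β × ℝ => φ z * ENNReal.ofReal (G z.1 z.2) :=
    hφ.mul hGm.ennreal_ofReal
  have hrm' : Measurable fun z : β × ℝ => φ z * ENNReal.ofReal (G z.1 z.2 / G₁ z.1) :=
    hφ.mul hqm.ennreal_ofReal
  rw [lintegral_prod _ hlm.aemeasurable, lintegral_prod _ hrm.aemeasurable]
  have key : ∀ a, ∫⁻ x, φ (s a, τ a x) * ENNReal.ofReal (F a x) =
      (∫⁻ y, φ (s a, y) * ENNReal.ofReal (G (s a) y / G₁ (s a))) * ENNReal.ofReal (F₁ a) := by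
    intro a
    rw [← lintegral_transport (hpc a) (hpi a) (hp a) (hqc (s a)) (hqi _) (hq _)
      (by rw [hp1, hq1]) (hτ a) fun y => φ (s a, y),
      ← lintegral_mul_const' _ _ ENNReal.ofReal_ne_top]
    refine lintegral_congr fun x => ?_
    rw [mul_assoc, ← ENNReal.ofReal_mul (hp a x).le, div_mul_cancel₀ _ (hF₁ a).ne']
  simp only [key]
  rw [hst (fun b => ∫⁻ y, φ (b, y) * ENNReal.ofReal (G b y / G₁ b)) hrm'.lintegral_prod_right']
  refine lintegral_congr fun b => ?_
  rw [← lintegral_mul_const' _ _ ENNReal.ofReal_ne_top]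
  refine lintegral_congr fun x => ?_
  rw [mul_assoc, ← ENNReal.ofReal_mul (hq b x).le, div_mul_cancel₀ _ (hG₁ b).ne']

lemma marginal_properties {X : Type*} [TopologicalSpace X] [FirstCountableTopology X]
    {F : X → ℝ → ℝ} (hFc : Continuous (Function.uncurry F)) (hF : ∀ x t, 0 < F x t)
    {k : ℝ → ℝ} (hk : Integrable k) (hk0 : ∀ t, 0 ≤ k t) {b : X → ℝ} {C : ℝ}
    (hbC : ∀ x, b x ≤ C) (hFb : ∀ x t, F x t ≤ b x * k t) :
    (∀ x, Integrable (F x)) ∧ Continuous (fun x => ∫ t, F x t) ∧ (∀ x, 0 < ∫ t, F x t) ∧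
      ∀ x, ∫ t, F x t ≤ b x * ∫ t, k t := by
  have hFc' : ∀ x, Continuous (F x) := fun x =>
    hFc.comp (f := fun t : ℝ => (x, t)) (by fun_prop)
  have hFi : ∀ x, Integrable (F x) := fun x =>
    (hk.const_mul (b x)).mono' (hFc' x).aestronglyMeasurable
      (ae_of_all _ fun t => by rw [Real.norm_of_nonneg (hF x t).le]; exact hFb x t)
  refine ⟨hFi, ?_, fun x => ?_, fun x => ?_⟩
  · refine continuous_of_dominated (bound := fun t => C * k t)
      (fun x => (hFc' x).aestronglyMeasurable) (fun x => ae_of_all _ fun t => ?_)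
      (hk.const_mul C) (ae_of_all _ fun t => hFc.comp (f := fun x : X => (x, t)) (by fun_prop))
    rw [Real.norm_of_nonneg (hF x t).le]
    exact (hFb x t).trans (mul_le_mul_of_nonneg_right (hbC x) (hk0 t))
  · rw [integral_pos_iff_support_of_nonneg (fun t => (hF x t).le) (hFi x)]
    have : Function.support (F x) = univ := eq_univ_of_forall fun t => (hF x t).ne'
    simp [this]
  · rw [← integral_const_mul]
    exact integral_mono (hFi x) (hk.const_mul _) (hFb x)

/-- Coordinates on `ℝ³` as an iterated product. -/
def toProd (x : E3) : (ℝ × ℝ) × ℝ := ((x 0, x 1), x 2)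

/-- The inverse of `toProd`. -/
def ofProd (z : (ℝ × ℝ) × ℝ) : E3 := !₂[z.1.1, z.1.2, z.2]

lemma ofProd_toProd (x : E3) : ofProd (toProd x) = x := by
  ext i
  fin_cases i <;> rfl

lemma toProd_ofProd (z : (ℝ × ℝ) × ℝ) : toProd (ofProd z) = z := rfl

lemma continuous_toProd : Continuous toProd := by
  unfold toProd; fun_prop

lemma continuous_ofProd : Continuous ofProd := by
  refine (PiLp.continuous_toLp 2 _).comp (continuous_pi fun i => ?_)
  fin_cases i <;> simp <;> fun_prop

lemma measurePreserving_toProd : MeasurePreserving toProd := by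
  have h1 : MeasurePreserving (@WithLp.ofLp 2 (Fin 3 → ℝ)) := PiLp.volume_preserving_ofLp (Fin 3)
  have h2 := volume_preserving_piFinSuccAbove (fun _ : Fin 3 => ℝ) 2
  have h3 : MeasurePreserving (Prod.swap : ℝ × (Fin 2 → ℝ) → (Fin 2 → ℝ) × ℝ) :=
    Measure.measurePreserving_swap
  have h4 := (volume_preserving_finTwoArrow ℝ).prod (MeasurePreserving.id (volume : Measure ℝ))
  exact h4.comp (h3.comp (h2.comp h1))

lemma measurePreserving_ofProd : MeasurePreserving ofProd :=
  measurePreserving_toProd.symm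
    (e := ⟨⟨toProd, ofProd, ofProd_toProd, toProd_ofProd⟩, continuous_toProd.measurable,
      continuous_ofProd.measurable⟩)

lemma measurableEmbedding_ofProd : MeasurableEmbedding ofProd :=
  (⟨⟨toProd, ofProd, ofProd_toProd, toProd_ofProd⟩, continuous_toProd.measurable,
      continuous_ofProd.measurable⟩ : E3 ≃ᵐ (ℝ × ℝ) × ℝ).symm.measurableEmbedding

/-- Positive continuous functions on `ℝ³` bounded by a multiple of `k ⊗ k ⊗ k`. -/
structure ProductDominated (k : ℝ → ℝ) (F : E3 → ℝ) : Prop where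
  continuous : Continuous F
  pos : ∀ x, 0 < F x
  le : ∃ C, ∀ x, F x ≤ C * (k (x 0) * k (x 1) * k (x 2))

lemma ProductDominated.integrable {k : ℝ → ℝ} (hk : Integrable k) {F : E3 → ℝ}
    (hF : ProductDominated k F) : Integrable F := by
  obtain ⟨C, hC⟩ := hF.le
  have h1 : Integrable (fun z : (ℝ × ℝ) × ℝ => k z.1.1 * k z.1.2 * k z.2) :=
    (hk.mul_prod hk).mul_prod hk
  have h2 : Integrable (fun x : E3 => k (x 0) * k (x 1) * k (x 2)) :=
    measurePreserving_toProd.integrable_comp_of_integrable h1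
  refine (h2.const_mul C).mono' hF.continuous.aestronglyMeasurable (ae_of_all _ fun x => ?_)
  rw [Real.norm_of_nonneg (hF.pos x).le]
  exact hC x

lemma ProductDominated.marginals {k : ℝ → ℝ} (hk : Integrable k) (hk0 : ∀ t, 0 ≤ k t)
    (hk1 : ∀ t, k t ≤ 1) {F : E3 → ℝ} (hF : ProductDominated k F) :
    ∃ (F₂ : ℝ × ℝ → ℝ) (F₁ : ℝ → ℝ),
      (∀ z, Integrable fun t => F (ofProd (z, t))) ∧ (∀ z, ∫ t, F (ofProd (z, t)) = F₂ z) ∧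
      Continuous F₂ ∧ (∀ z, 0 < F₂ z) ∧ (∀ a, Integrable fun b => F₂ (a, b)) ∧
      (∀ a, ∫ b, F₂ (a, b) = F₁ a) ∧ Continuous F₁ ∧ (∀ a, 0 < F₁ a) ∧ Integrable F₁ ∧
      ∫ a, F₁ a = ∫ x, F x := by
  obtain ⟨C, hC⟩ := hF.le
  have hC0 : 0 ≤ C := by
    by_contra! h
    have h1 := hC 0
    have h2 := hF.pos 0
    have h3 := mul_nonneg (mul_nonneg (hk0 ((0 : E3) 0)) (hk0 ((0 : E3) 1))) (hk0 ((0 : E3) 2))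
    nlinarith
  have hJ : 0 ≤ ∫ t, k t := integral_nonneg hk0
  obtain ⟨i2, c2, p2, l2⟩ := marginal_properties
    (F := fun (z : ℝ × ℝ) t => F (ofProd (z, t))) (k := k) (b := fun z => C * (k z.1 * k z.2))
    (C := C) (hF.continuous.comp continuous_ofProd) (fun _ _ => hF.pos _) hk hk0
    (fun z => mul_le_of_le_one_right hC0 (mul_le_one₀ (hk1 _) (hk0 _) (hk1 _)))
    (fun z t => (hC _).trans_eq (by simp [ofProd]; ring))
  obtain ⟨i1, c1, p1, l1⟩ := marginal_properties
    (F := fun a b => ∫ t, F (ofProd ((a, b), t))) (k := k)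
    (b := fun a => C * (∫ t, k t) * k a) (C := C * (∫ t, k t))
    (c2.comp (f := fun z : ℝ × ℝ => (z.1, z.2)) (by fun_prop)) (fun _ _ => p2 _) hk hk0
    (fun a => mul_le_of_le_one_right (mul_nonneg hC0 hJ) (hk1 _))
    (fun a b => (l2 _).trans_eq (by simp; ring))
  refine ⟨fun z => ∫ t, F (ofProd (z, t)), fun a => ∫ b, ∫ t, F (ofProd ((a, b), t)), i2,
    fun _ => rfl, c2, p2, i1, fun _ => rfl, c1, p1, ?_, ?_⟩
  · refine (((hk.const_mul (C * ∫ t, k t)).mul_const (∫ t, k t))).mono'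
      c1.aestronglyMeasurable (ae_of_all _ fun a => ?_)
    rw [Real.norm_of_nonneg (p1 a).le]
    exact l1 a
  · have hi : Integrable fun z : (ℝ × ℝ) × ℝ => F (ofProd z) :=
      measurePreserving_ofProd.integrable_comp_of_integrable (hF.integrable hk)
    have h1 : ∫ x, F x = ∫ z : (ℝ × ℝ) × ℝ, F (ofProd z) :=
      (measurePreserving_ofProd.integral_comp measurableEmbedding_ofProd F).symm
    rw [h1]
    rw [Measure.volume_eq_prod, integral_prod _ hi]
    rw [Measure.volume_eq_prod, integral_prod _ hi.integral_prod_left]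

/-- The Knothe rearrangement on `ℝ³`. -/
lemma exists_knothe {k : ℝ → ℝ} (hk : Integrable k) (hk0 : ∀ t, 0 ≤ k t)
    (hk1 : ∀ t, k t ≤ 1) {F G : E3 → ℝ} (hF : ProductDominated k F) (hG : ProductDominated k G)
    (hFG : ∫ x, F x = ∫ x, G x) :
    ∃ (T : E3 → E3) (D : Fin 3 → E3 → ℝ), Measurable T ∧
      (∀ i x, HasLineDerivAt ℝ (fun y => T y i) (D i x) x (e3 i)) ∧
      (∀ i, Measurable (D i)) ∧ (∀ i x, 0 < D i x) ∧
      (∀ x, D 0 x * D 1 x * D 2 x * G (T x) = F x) ∧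
      ∀ φ : E3 → ℝ≥0∞, Measurable φ →
        ∫⁻ x, φ (T x) * ENNReal.ofReal (F x) = ∫⁻ y, φ y * ENNReal.ofReal (G y) := by
  obtain ⟨F₂, F₁, Fi3, FF2, Fc2, Fp2, Fi2, FF1, Fc1, Fp1, Fi1, FF0⟩ := hF.marginals hk hk0 hk1
  obtain ⟨G₂, G₁, Gi3, GG2, Gc2, Gp2, Gi2, GG1, Gc1, Gp1, Gi1, GG0⟩ := hG.marginals hk hk0 hk1
  have h0 : ∫ t, F₁ t = ∫ t, G₁ t := by rw [FF0, GG0, hFG]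
  have hex : ∀ x, ∃ y, ∫ t in Iic y, G₁ t = ∫ t in Iic x, F₁ t := fun x =>
    exists_integral_Iic_eq Gc1 Gi1 (h0 ▸ integral_Iic_mem_Ioo Fc1 Fi1 Fp1 x)
  choose σ hσ using hex
  have hσd := hasDerivAt_transport Fc1 Fi1 Fp1 Gc1 Gi1 Gp1 h0 hσ
  have hσm : Measurable σ :=
    (continuous_iff_continuousAt.2 fun x => (hσd x).continuousAt).measurable
  obtain ⟨τ, hτm, hτd, hτφ⟩ := exists_knothe_step (μ := volume) (ν := volume) hσm
    Fc1.measurable Gc1.measurable Fp1 Gp1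
    (fun φ _ => lintegral_transport Fc1 Fi1 Fp1 Gc1 Gi1 Gp1 h0 hσ φ)
    (F := fun a b => F₂ (a, b)) (G := fun a b => G₂ (a, b)) Fc2.measurable Gc2.measurable
    (fun _ _ => Fp2 _) (fun _ _ => Gp2 _) (fun _ => by fun_prop) (fun _ => by fun_prop)
    Fi2 Gi2 FF1 GG1
  have hFo := hF.continuous.comp continuous_ofProd
  have hGo := hG.continuous.comp continuous_ofProd
  obtain ⟨ρ, hρm, hρd, hρφ⟩ := exists_knothe_step (μ := volume.prod volume)
    (ν := volume.prod volume) (s := fun z : ℝ × ℝ => (σ z.1, τ z.1 z.2))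
    ((hσm.comp measurable_fst).prodMk hτm)
    Fc2.measurable Gc2.measurable Fp2 Gp2 hτφ
    (F := fun z t => F (ofProd (z, t))) (G := fun z t => G (ofProd (z, t)))
    hFo.measurable hGo.measurable (fun _ _ => hF.pos _) (fun _ _ => hG.pos _)
    (fun z => hFo.comp (f := fun t : ℝ => (z, t)) (by fun_prop))
    (fun z => hGo.comp (f := fun t : ℝ => (z, t)) (by fun_prop))
    Fi3 Gi3 FF2 GG2
  set S : (ℝ × ℝ) × ℝ → (ℝ × ℝ) × ℝ :=
    fun z => ((σ z.1.1, τ z.1.1 z.1.2), ρ z.1 z.2) with hS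
  have hSm : Measurable S :=
    ((hσm.comp (measurable_fst.comp measurable_fst)).prodMk (hτm.comp measurable_fst)).prodMk hρm
  have hTm : Measurable fun x => ofProd (S (toProd x)) :=
    continuous_ofProd.measurable.comp (hSm.comp continuous_toProd.measurable)
  set D : Fin 3 → E3 → ℝ := ![
    fun x => F₁ (x 0) / G₁ (σ (x 0)),
    fun x => F₂ (x 0, x 1) / F₁ (x 0) / (G₂ (σ (x 0), τ (x 0) (x 1)) / G₁ (σ (x 0))),
    fun x => F x / F₂ (x 0, x 1) /
      (G (ofProd (S (toProd x))) / G₂ (σ (x 0), τ (x 0) (x 1)))] with hD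
  have hx0 : Measurable fun x : E3 => x 0 := by fun_prop
  have hx1 : Measurable fun x : E3 => x 1 := by fun_prop
  have hτ' : Measurable fun x : E3 => τ (x 0) (x 1) := hτm.comp (hx0.prodMk hx1)
  have hG2' : Measurable fun x : E3 => G₂ (σ (x 0), τ (x 0) (x 1)) :=
    Gc2.measurable.comp ((hσm.comp hx0).prodMk hτ')
  have hG1' : Measurable fun x : E3 => G₁ (σ (x 0)) := Gc1.measurable.comp (hσm.comp hx0)
  have hF1' : Measurable fun x : E3 => F₁ (x 0) := Fc1.measurable.comp hx0
  have hF2' : Measurable fun x : E3 => F₂ (x 0, x 1) := Fc2.measurable.comp (hx0.prodMk hx1)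
  refine ⟨fun x => ofProd (S (toProd x)), D, hTm, ?_, ?_, ?_, ?_, ?_⟩
  · intro i x
    unfold HasLineDerivAt
    fin_cases i
    · have h : HasDerivAt σ (D 0 x) (x 0 + 0) := by rw [add_zero]; exact hσd _
      refine (h.comp_const_add (x 0) 0).congr_of_eventuallyEq (Eventually.of_forall fun t => ?_)
      simp [ofProd, toProd, hS, e3]
    · have h : HasDerivAt (τ (x 0)) (D 1 x) (x 1 + 0) := by rw [add_zero]; exact hτd _ _
      refine (h.comp_const_add (x 1) 0).congr_of_eventuallyEq (Eventually.of_forall fun t => ?_)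
      simp [ofProd, toProd, hS, e3]
    · have h : HasDerivAt (ρ (x 0, x 1)) (D 2 x) (x 2 + 0) := by
        have h' := hρd (x 0, x 1) (x 2)
        rw [show ofProd ((x 0, x 1), x 2) = x from ofProd_toProd x] at h'
        rw [add_zero]
        exact h'
      refine (h.comp_const_add (x 2) 0).congr_of_eventuallyEq (Eventually.of_forall fun t => ?_)
      simp [ofProd, toProd, hS, e3]
  · intro i
    fin_cases i
    · exact hF1'.div hG1'
    · exact (hF2'.div hF1').div (hG2'.div hG1')
    · exact (hF.continuous.measurable.div hF2').div ((hG.continuous.measurable.comp hTm).div hG2')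
  · intro i x
    have := hF.pos x
    have := hG.pos (ofProd (S (toProd x)))
    have := Fp1 (x 0)
    have := Gp1 (σ (x 0))
    have := Fp2 (x 0, x 1)
    have := Gp2 (σ (x 0), τ (x 0) (x 1))
    fin_cases i <;> simp [hD] <;> positivity
  · intro x
    have := hF.pos x
    have := hG.pos (ofProd (S (toProd x)))
    have := Fp1 (x 0)
    have := Gp1 (σ (x 0))
    have := Fp2 (x 0, x 1)
    have := Gp2 (σ (x 0), τ (x 0) (x 1))
    simp [hD]
    field_simp
  · intro φ hφ
    have hφ' := hφ.comp continuous_ofProd.measurable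
    have h := hρφ (fun z => φ (ofProd z)) hφ'
    rw [← Measure.volume_eq_prod, ← Measure.volume_eq_prod] at h
    rw [← measurePreserving_ofProd.lintegral_comp_emb measurableEmbedding_ofProd,
      ← measurePreserving_ofProd.lintegral_comp_emb measurableEmbedding_ofProd]
    exact h

lemma exists_norm_lt_one_of_integrable {w : ℝ → ℝ} (hw : Integrable w) (s : Set ℝ)
    (hs : volume s = ∞) : ∃ x ∈ s, ‖w x‖ < 1 := by
  by_contra! h
  have h1 := hw.measure_norm_ge_lt_top zero_lt_one
  exact (lt_irrefl _ (((measure_mono h).trans_lt h1).trans_eq hs.symm))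

/-- Integration by parts on the line when the derivative of one factor is nonnegative; the
integrability of `u * v'` is part of the conclusion. -/
lemma integral_mul_deriv_of_nonneg {u u' v v' : ℝ → ℝ} (hu : ∀ x, HasDerivAt u (u' x) x)
    (hv : ∀ x, HasDerivAt v (v' x) x) (hu'c : Continuous u') (hu0 : ∀ x, 0 ≤ u x)
    (hv0 : ∀ x, 0 ≤ v' x) (hu'v : Integrable fun x => u' x * v x)
    (huv : Integrable fun x => u x * v x) :
    Integrable (fun x => u x * v' x) ∧ ∫ x, u x * v' x = -∫ x, u' x * v x := by
  have huc : Continuous u := continuous_iff_continuousAt.2 fun x => (hu x).continuousAt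
  have hvc : Continuous v := continuous_iff_continuousAt.2 fun x => (hv x).continuousAt
  have hv'i : ∀ a b, IntervalIntegrable v' volume a b := fun a b =>
    intervalIntegral.intervalIntegrable_deriv_of_nonneg hvc.continuousOn
      (fun x _ => hv x) fun x _ => hv0 x
  have huv'i : ∀ a b, IntervalIntegrable (fun x => u x * v' x) volume a b := fun a b =>
    (hv'i a b).continuousOn_mul huc.continuousOn
  have hb : ∀ n : ℕ, ∃ x ∈ Ici (n : ℝ), ‖u x * v x‖ < 1 := fun n =>
    exists_norm_lt_one_of_integrable huv _ (by simp)
  have ha : ∀ n : ℕ, ∃ x ∈ Iic (-n : ℝ), ‖u x * v x‖ < 1 := fun n =>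
    exists_norm_lt_one_of_integrable huv _ (by simp)
  choose b hbn hb1 using hb
  choose a han ha1 using ha
  have hbt : Tendsto b atTop atTop := tendsto_atTop_mono hbn tendsto_natCast_atTop_atTop
  have hat : Tendsto a atTop atBot :=
    tendsto_atBot_mono han (tendsto_neg_atTop_atBot.comp tendsto_natCast_atTop_atTop)
  have hint : Integrable fun x => u x * v' x := by
    refine integrable_of_intervalIntegral_norm_bounded (2 + ∫ x, ‖u' x * v x‖)
      (fun n => (huv'i (a n) (b n)).1) hat hbt (Eventually.of_forall fun n => ?_)
    have hab : a n ≤ b n := by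
      have h1 := hbn n
      have h2 := han n
      simp only [mem_Ici, mem_Iic] at h1 h2
      have : (0 : ℝ) ≤ n := n.cast_nonneg
      linarith
    have h1 : ∀ x, ‖u x * v' x‖ = u x * v' x := fun x =>
      Real.norm_of_nonneg (mul_nonneg (hu0 x) (hv0 x))
    simp only [h1]
    rw [intervalIntegral.integral_mul_deriv_eq_deriv_mul (fun x _ => hu x) (fun x _ => hv x)
      (hu'c.intervalIntegrable _ _) (hv'i _ _)]
    have h2 : |∫ x in a n..b n, u' x * v x| ≤ ∫ x, ‖u' x * v x‖ := by
      rw [← Real.norm_eq_abs]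
      refine (intervalIntegral.norm_integral_le_integral_norm hab).trans ?_
      rw [intervalIntegral.integral_of_le hab]
      exact setIntegral_le_integral hu'v.norm (ae_of_all _ fun x => norm_nonneg _)
    have h3 := abs_lt.1 (hb1 n)
    have h4 := abs_lt.1 (ha1 n)
    have h5 := abs_le.1 h2
    linarith
  exact ⟨hint, integral_mul_deriv_eq_deriv_mul_of_integrable (fun x _ => hu x) (fun x _ => hv x)
    hint hu'v huv⟩

/-- Coordinates on `ℝ³` singling out the `i`-th axis. -/
def lineCoords (i : Fin 3) (z : ℝ × (Fin 2 → ℝ)) : E3 :=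
  WithLp.toLp 2 (i.insertNth z.1 z.2 : Fin 3 → ℝ)

lemma lineCoords_add (i : Fin 3) (t s : ℝ) (y : Fin 2 → ℝ) :
    lineCoords i (t + s, y) = lineCoords i (t, y) + s • e3 i := by
  ext j
  refine Fin.succAboveCases i ?_ (fun j => ?_) j
  · simp [lineCoords, e3]
  · simp [lineCoords, e3, Fin.succAbove_ne]

/-- `lineCoords` as a measurable equivalence. -/
def lineCoordsEquiv (i : Fin 3) : ℝ × (Fin 2 → ℝ) ≃ᵐ E3 :=
  (MeasurableEquiv.piFinSuccAbove (fun _ : Fin 3 => ℝ) i).symm.trans (MeasurableEquiv.toLp 2 _)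

lemma measurePreserving_lineCoords (i : Fin 3) : MeasurePreserving (lineCoords i) :=
  (PiLp.volume_preserving_toLp (Fin 3)).comp
    (volume_preserving_piFinSuccAbove (fun _ : Fin 3 => ℝ) i).symm

lemma measurableEmbedding_lineCoords (i : Fin 3) : MeasurableEmbedding (lineCoords i) :=
  (lineCoordsEquiv i).measurableEmbedding

lemma HasLineDerivAt.hasDerivAt_lineCoords {i : Fin 3} {f f' : E3 → ℝ}
    (hf : ∀ x, HasLineDerivAt ℝ f (f' x) x (e3 i)) (y : Fin 2 → ℝ) (t : ℝ) :
    HasDerivAt (fun t => f (lineCoords i (t, y))) (f' (lineCoords i (t, y))) t := by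
  have h : HasDerivAt (fun s : ℝ => f (lineCoords i (t, y) + s • e3 i)) (f' (lineCoords i (t, y))) 0 :=
    hf _
  simp only [← lineCoords_add] at h
  have h2 : HasDerivAt (fun s => f (lineCoords i (t + s, y))) (f' (lineCoords i (t, y))) (-t + t) := by
    simpa using h
  simpa using h2.comp_const_add (-t) t

/-- Integration by parts in the `i`-th coordinate direction of `ℝ³`, for a factor `v` that is
increasing in that direction. -/
lemma integral_mul_lineDeriv_of_nonneg (i : Fin 3) {u u' v v' w : E3 → ℝ}
    (hu : ∀ x, HasLineDerivAt ℝ u (u' x) x (e3 i)) (hv : ∀ x, HasLineDerivAt ℝ v (v' x) x (e3 i))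
    (hum : Measurable u) (hv'm : Measurable v') (hu'c : Continuous u') (hu0 : ∀ x, 0 ≤ u x)
    (hv0 : ∀ x, 0 ≤ v' x) (hu'v : Integrable fun x => u' x * v x) (hw : Integrable w)
    (huv : ∀ y, (Integrable fun t => w (lineCoords i (t, y))) →
      Integrable fun t => u (lineCoords i (t, y)) * v (lineCoords i (t, y))) :
    Integrable (fun x => u x * v' x) ∧ ∫ x, u x * v' x = -∫ x, u' x * v x := by
  have hmp := measurePreserving_lineCoords i
  have hem := measurableEmbedding_lineCoords i
  have hcont : ∀ y, Continuous fun t => lineCoords i (t, y) := fun y => by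
    have h : (fun t => lineCoords i (t, y)) = fun t => lineCoords i (0, y) + t • e3 i := by
      ext1 t; rw [← lineCoords_add, zero_add]
    rw [h]; fun_prop
  have h1 : Integrable (fun z => u' (lineCoords i z) * v (lineCoords i z)) :=
    hmp.integrable_comp_of_integrable hu'v
  have h2 : Integrable (fun z => w (lineCoords i z)) := hmp.integrable_comp_of_integrable hw
  rw [Measure.volume_eq_prod] at h1 h2
  have key : ∀ᵐ y : Fin 2 → ℝ,
      (Integrable fun t => u (lineCoords i (t, y)) * v' (lineCoords i (t, y))) ∧
      ∫ t, u (lineCoords i (t, y)) * v' (lineCoords i (t, y)) =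
        -∫ t, u' (lineCoords i (t, y)) * v (lineCoords i (t, y)) := by
    filter_upwards [h1.prod_left_ae, h2.prod_left_ae] with y hy1 hy2
    exact integral_mul_deriv_of_nonneg (HasLineDerivAt.hasDerivAt_lineCoords hu y)
      (HasLineDerivAt.hasDerivAt_lineCoords hv y) (hu'c.comp (hcont y)) (fun _ => hu0 _)
      (fun _ => hv0 _) hy1 (huv y hy2)
  have hi : Integrable (fun z => u (lineCoords i z) * v' (lineCoords i z)) := by
    rw [Measure.volume_eq_prod, integrable_prod_iff']
    · refine ⟨key.mono fun y hy => hy.1, h1.integral_prod_right.neg.congr ?_⟩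
      filter_upwards [key] with y hy
      rw [Pi.neg_apply, ← hy.2]
      exact integral_congr_ae (ae_of_all _ fun t =>
        (Real.norm_of_nonneg (mul_nonneg (hu0 _) (hv0 _))).symm)
    · exact ((hum.comp hem.measurable).mul (hv'm.comp hem.measurable)).aestronglyMeasurable
  refine ⟨(hmp.integrable_comp_emb hem).1 hi, ?_⟩
  rw [← hmp.integral_comp hem, ← hmp.integral_comp hem]
  rw [Measure.volume_eq_prod] at hi ⊢
  rw [integral_prod_symm _ hi, integral_prod_symm _ h1, ← integral_neg]
  exact integral_congr_ae (key.mono fun y hy => hy.2)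

lemma W_pos (x : E3) : 0 < W x := Real.rpow_pos_of_pos (by positivity) _

lemma W_sq (x : E3) : W x ^ 2 = (1 + ‖x‖ ^ 2 / 3)⁻¹ := by
  unfold W
  rw [← Real.rpow_natCast, ← Real.rpow_mul (by positivity)]
  norm_num
  rw [Real.rpow_neg_one]

lemma norm_sq_eq (x : E3) : ‖x‖ ^ 2 = x 0 ^ 2 + x 1 ^ 2 + x 2 ^ 2 := by
  rw [EuclideanSpace.norm_sq_eq, Fin.sum_univ_three]
  simp

lemma apply_sq_le (i : Fin 3) (x : E3) : x i ^ 2 ≤ ‖x‖ ^ 2 := by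
  have := Finset.single_le_sum (f := fun i => ‖x i‖ ^ 2) (fun _ _ => by positivity)
    (Finset.mem_univ i)
  rw [EuclideanSpace.norm_sq_eq]
  simpa using this

lemma contDiff_W : ContDiff ℝ 1 W := by
  unfold W
  refine ContDiff.rpow_const_of_ne ?_ fun x => by positivity
  exact contDiff_const.add ((contDiff_norm_sq ℝ).div_const 3)

lemma pdR_W (i : Fin 3) (x : E3) : pdR i W x = -(1 / 3) * x i * W x ^ 3 := by
  have h1 : HasFDerivAt (fun y : E3 => 1 + ‖y‖ ^ 2 / 3) ((2 / 3 : ℝ) • innerSL ℝ x) x := by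
    have := ((hasStrictFDerivAt_norm_sq x).hasFDerivAt.mul_const (3 : ℝ)⁻¹).const_add 1
    refine this.congr_fderiv ?_
    ext y
    simp
    ring
  have h2 : (0 : ℝ) < 1 + ‖x‖ ^ 2 / 3 := by positivity
  have h3 := h1.rpow_const (p := -(1 : ℝ) / 2) (Or.inl h2.ne')
  have h4 : W x ^ 3 = (1 + ‖x‖ ^ 2 / 3) ^ (-(1 : ℝ) / 2 - 1) := by
    unfold W
    rw [← Real.rpow_natCast, ← Real.rpow_mul h2.le]
    norm_num
  have h5 : fderiv ℝ W x = _ := h3.fderiv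
  rw [pdR, h5, h4]
  simp [e3, EuclideanSpace.inner_single_right]
  ring

lemma gradSqR_W (x : E3) : gradSqR W x = ‖x‖ ^ 2 * W x ^ 6 / 9 := by
  simp only [gradSqR, pdR_W, Fin.sum_univ_three, norm_sq_eq]
  ring

/-- The one-dimensional profile of `W ^ 2`. -/
def cauchyKernel (t : ℝ) : ℝ := (1 + t ^ 2 / 3)⁻¹

lemma cauchyKernel_nonneg (t : ℝ) : 0 ≤ cauchyKernel t := by unfold cauchyKernel; positivity

lemma cauchyKernel_le_one (t : ℝ) : cauchyKernel t ≤ 1 :=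
  inv_le_one_of_one_le₀ (le_add_of_nonneg_right (by positivity))

lemma integrable_cauchyKernel : Integrable cauchyKernel := by
  refine (integrable_inv_one_add_sq.const_mul 3).mono' (Measurable.aestronglyMeasurable
    (by unfold cauchyKernel; fun_prop)) (ae_of_all _ fun t => ?_)
  rw [Real.norm_of_nonneg (cauchyKernel_nonneg t), cauchyKernel, ← div_eq_mul_inv,
    inv_eq_one_div, div_le_div_iff₀ (by positivity) (by positivity)]
  nlinarith [sq_nonneg t]

lemma W_sq_le (i : Fin 3) (x : E3) : W x ^ 2 ≤ cauchyKernel (x i) := by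
  rw [W_sq, cauchyKernel]
  have := apply_sq_le i x
  exact inv_anti₀ (by positivity) (by linarith)

lemma W_pow_six_le (x : E3) :
    W x ^ 6 ≤ cauchyKernel (x 0) * cauchyKernel (x 1) * cauchyKernel (x 2) := by
  have h0 := W_sq_le 0 x
  have h1 := W_sq_le 1 x
  have h2 := W_sq_le 2 x
  calc W x ^ 6 = W x ^ 2 * W x ^ 2 * W x ^ 2 := by ring
    _ ≤ _ := by
      have := sq_nonneg (W x)
      have := cauchyKernel_nonneg (x 0)
      have := cauchyKernel_nonneg (x 1)
      gcongr

lemma continuous_W : Continuous W := contDiff_W.continuous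

lemma integrable_W_pow_four : Integrable fun x => W x ^ 4 := by
  have h : Integrable fun x : E3 => ((1 : ℝ) + ‖x‖ ^ 2) ^ (-(4 : ℝ) / 2) :=
    integrable_rpow_neg_one_add_norm_sq (by simp; norm_num)
  refine (h.const_mul 9).mono' (continuous_W.pow 4).aestronglyMeasurable (ae_of_all _ fun x => ?_)
  have h2 : ((1 : ℝ) + ‖x‖ ^ 2) ^ (-(4 : ℝ) / 2) = ((1 + ‖x‖ ^ 2) ^ 2)⁻¹ := by
    rw [show (-(4 : ℝ) / 2) = -((2 : ℕ) : ℝ) by norm_num, Real.rpow_neg (by positivity),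
      Real.rpow_natCast]
  rw [Real.norm_of_nonneg (pow_nonneg (W_pos x).le 4), h2,
    show W x ^ 4 = (W x ^ 2) ^ 2 by ring, W_sq, ← inv_pow,
    show (9 : ℝ) * ((1 + ‖x‖ ^ 2)⁻¹) ^ 2 = (3 * (1 + ‖x‖ ^ 2)⁻¹) ^ 2 by ring]
  gcongr
  rw [← div_eq_mul_inv, inv_eq_one_div, div_le_div_iff₀ (by positivity) (by positivity)]
  nlinarith [sq_nonneg ‖x‖]

lemma W_pow_six_mul (x : E3) : (1 + ‖x‖ ^ 2 / 3) * W x ^ 6 = W x ^ 4 := by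
  have h := W_sq x
  rw [show W x ^ 6 = W x ^ 2 * W x ^ 4 by ring, h]
  have : (1 + ‖x‖ ^ 2 / 3) ≠ 0 := by positivity
  field_simp

lemma integrable_norm_sq_mul_W_pow_six : Integrable fun x => ‖x‖ ^ 2 * W x ^ 6 := by
  refine (integrable_W_pow_four.const_mul 3).mono' (Continuous.aestronglyMeasurable
    (by have := continuous_W; fun_prop)) (ae_of_all _ fun x => ?_)
  have := pow_nonneg (W_pos x).le 6
  rw [Real.norm_of_nonneg (by positivity), ← W_pow_six_mul]
  nlinarith

lemma integrable_gradSqR_W : Integrable (gradSqR W) := by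
  have h : gradSqR W = fun x => ‖x‖ ^ 2 * W x ^ 6 / 9 := funext gradSqR_W
  rw [h]
  exact integrable_norm_sq_mul_W_pow_six.div_const 9

lemma hasLineDerivAt_of_contDiff {h : E3 → ℝ} (hh : ContDiff ℝ 1 h) (i : Fin 3) (x : E3) :
    HasLineDerivAt ℝ h (pdR i h x) x (e3 i) :=
  (hh.differentiable one_ne_zero x).hasFDerivAt.hasLineDerivAt (e3 i)

lemma continuous_pdR {h : E3 → ℝ} (hh : ContDiff ℝ 1 h) (i : Fin 3) : Continuous (pdR i h) :=
  (hh.continuous_fderiv one_ne_zero).clm_apply continuous_const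

/-- Integration by parts of `h ^ 4` against a vector field component, for `h` decaying like `W`. -/
lemma integral_pow_four_mul {h : E3 → ℝ} (hh : ContDiff ℝ 1 h) (hh0 : ∀ x, 0 < h x) {C : ℝ}
    (hhC : ∀ x, h x ≤ C * W x) (i : Fin 3) (hg : Integrable fun x => pdR i h x ^ 2)
    {v v' : E3 → ℝ} (hv : ∀ x, HasLineDerivAt ℝ v (v' x) x (e3 i)) (hvm : Measurable v)
    (hv'm : Measurable v') (hv0 : ∀ x, 0 ≤ v' x) (hw : Integrable fun x => v x ^ 2 * h x ^ 6) :
    Integrable (fun x => 4 * h x ^ 3 * pdR i h x * v x) ∧ Integrable (fun x => h x ^ 4 * v' x) ∧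
      ∫ x, h x ^ 4 * v' x = -∫ x, 4 * h x ^ 3 * pdR i h x * v x := by
  have hc := hh.continuous
  have hdc := continuous_pdR hh i
  have hi : Integrable (fun x => 4 * h x ^ 3 * pdR i h x * v x) := by
    refine ((hw.add hg).const_mul 2).mono' (Measurable.aestronglyMeasurable
      (by have := hc.measurable; have := hdc.measurable; fun_prop)) (ae_of_all _ fun x => ?_)
    rw [Real.norm_eq_abs, abs_le, Pi.add_apply]
    constructor <;> nlinarith [sq_nonneg (h x ^ 3 * v x - pdR i h x),
      sq_nonneg (h x ^ 3 * v x + pdR i h x)]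
  refine ⟨hi, integral_mul_lineDeriv_of_nonneg i (u := fun x => h x ^ 4)
    (u' := fun x => 4 * h x ^ 3 * pdR i h x) (fun x => ?_) hv (hc.pow 4).measurable hv'm
    (by fun_prop) (fun x => by positivity) hv0 hi hw fun y hy => ?_⟩
  · have := HasDerivAt.pow (hasLineDerivAt_of_contDiff hh i x) 4
    unfold HasLineDerivAt
    convert! this using 1
    simp
  · have hk : Integrable fun t => C ^ 2 * cauchyKernel t := integrable_cauchyKernel.const_mul _
    have hm : Measurable fun t : ℝ => lineCoords i (t, y) :=
      (measurableEmbedding_lineCoords i).measurable.comp (by fun_prop)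
    refine (hy.add hk).mono' (Measurable.aestronglyMeasurable
      (((hc.measurable.comp hm).pow_const 4).mul (hvm.comp hm))) (ae_of_all _ fun t => ?_)
    set x := lineCoords i (t, y) with hx
    have hxi : x i = t := by simp [hx, lineCoords]
    have h1 : h x ^ 2 ≤ C ^ 2 * cauchyKernel t := by
      calc h x ^ 2 ≤ (C * W x) ^ 2 := by have := (hh0 x).le; have := hhC x; gcongr
        _ = C ^ 2 * W x ^ 2 := by ring
        _ ≤ _ := by have := W_sq_le i x; rw [hxi] at this; gcongr
    rw [Real.norm_eq_abs, abs_le, Pi.add_apply]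
    constructor <;> nlinarith [sq_nonneg (h x ^ 3 * v x - h x), sq_nonneg (h x ^ 3 * v x + h x),
      sq_nonneg (h x), sq_nonneg (h x ^ 3 * v x)]

lemma integral_norm_sq_mul_W_pow_six :
    ∫ x, ‖x‖ ^ 2 * W x ^ 6 = 9 * ∫ x, gradSqR W x := by
  simp only [gradSqR_W]
  rw [integral_div]
  ring

lemma integrable_pdR_sq {h : E3 → ℝ} (hh : ContDiff ℝ 1 h) (hg : Integrable (gradSqR h))
    (i : Fin 3) : Integrable fun x => pdR i h x ^ 2 := by
  refine hg.mono' ((continuous_pdR hh i).pow 2).aestronglyMeasurable (ae_of_all _ fun x => ?_)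
  rw [Real.norm_of_nonneg (sq_nonneg _)]
  exact Finset.single_le_sum (f := fun i => pdR i h x ^ 2) (fun _ _ => sq_nonneg _)
    (Finset.mem_univ i)

lemma integral_W_pow_four : ∫ x, W x ^ 4 = 4 * ∫ x, gradSqR W x := by
  have key : ∀ i, Integrable (fun x : E3 => x i ^ 2 * W x ^ 6) ∧
      ∫ x, W x ^ 4 = 4 / 3 * ∫ x : E3, x i ^ 2 * W x ^ 6 := by
    intro i
    have hi : Integrable (fun x : E3 => x i ^ 2 * W x ^ 6) := by
      refine integrable_norm_sq_mul_W_pow_six.mono' (Continuous.aestronglyMeasurable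
        (by have := continuous_W; fun_prop)) (ae_of_all _ fun x => ?_)
      have := pow_pos (W_pos x) 6
      rw [Real.norm_of_nonneg (by positivity)]
      have := apply_sq_le i x
      gcongr
    refine ⟨hi, ?_⟩
    have h := (integral_pow_four_mul contDiff_W W_pos (C := 1) (fun x => by simp) i
      (integrable_pdR_sq contDiff_W integrable_gradSqR_W i) (v := fun x => x i) (v' := fun _ => 1)
      (fun x => ?_) (by fun_prop) measurable_const (fun _ => zero_le_one) hi).2.2
    · simp only [mul_one] at h
      rw [h, ← integral_const_mul, ← integral_neg]
      congr 1 with x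
      rw [pdR_W]
      ring
    · have h : HasDerivAt (fun t : ℝ => x i + t) 1 0 := (hasDerivAt_id _).const_add _
      unfold HasLineDerivAt
      simpa [e3] using h
  have h2 := integral_norm_sq_mul_W_pow_six
  simp only [norm_sq_eq, add_mul] at h2
  have h3 : Integrable fun x : E3 => x 0 ^ 2 * W x ^ 6 + x 1 ^ 2 * W x ^ 6 :=
    (key 0).1.add (key 1).1
  rw [integral_add h3 (key 2).1, integral_add (key 0).1 (key 1).1] at h2
  have := (key 0).2
  have := (key 1).2
  have := (key 2).2
  linarith

lemma integral_comp_mul_of_lintegral {T : E3 → E3} {F G ψ : E3 → ℝ} (hT : Measurable T)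
    (hF : Measurable F) (hF0 : ∀ x, 0 ≤ F x) (hG0 : ∀ x, 0 ≤ G x)
    (hTFG : ∀ φ : E3 → ℝ≥0∞, Measurable φ →
      ∫⁻ x, φ (T x) * ENNReal.ofReal (F x) = ∫⁻ y, φ y * ENNReal.ofReal (G y))
    (hψ : Measurable ψ) (hψ0 : ∀ y, 0 ≤ ψ y) (hi : Integrable fun y => ψ y * G y) :
    Integrable (fun x => ψ (T x) * F x) ∧ ∫ x, ψ (T x) * F x = ∫ y, ψ y * G y := by
  have h := hTFG (fun y => ENNReal.ofReal (ψ y)) hψ.ennreal_ofReal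
  simp only [← ENNReal.ofReal_mul (hψ0 _)] at h
  have hm : AEStronglyMeasurable (fun x => ψ (T x) * F x) :=
    ((hψ.comp hT).mul hF).aestronglyMeasurable
  have h1 : ∀ᵐ x, 0 ≤ ψ (T x) * F x := ae_of_all _ fun x => mul_nonneg (hψ0 _) (hF0 _)
  have h2 : ∀ᵐ y, 0 ≤ ψ y * G y := ae_of_all _ fun y => mul_nonneg (hψ0 _) (hG0 _)
  constructor
  · rw [← lintegral_ofReal_ne_top_iff_integrable hm h1, h]
    exact (lintegral_ofReal_ne_top_iff_integrable hi.aestronglyMeasurable h2).2 hi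
  · rw [integral_eq_lintegral_of_nonneg_ae h1 hm,
      integral_eq_lintegral_of_nonneg_ae h2 hi.aestronglyMeasurable, h]

lemma integral_pos_of_forall_pos {F : E3 → ℝ} (hF0 : ∀ x, 0 < F x)
    (hi : Integrable F) : 0 < ∫ x, F x :=
  (integral_pos_iff_support_of_nonneg (fun x => (hF0 x).le) hi).2 (by
    rw [Function.support_eq_univ fun x => (hF0 x).ne']
    exact isOpen_univ.measure_pos _ univ_nonempty)

lemma integral_W_pow_four_pos : 0 < ∫ x, W x ^ 4 :=
  integral_pos_of_forall_pos (fun x => pow_pos (W_pos x) 4)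
    integrable_W_pow_four

lemma integral_gradSqR_W_pos : 0 < ∫ x, gradSqR W x := by
  have := integral_W_pow_four_pos
  rw [integral_W_pow_four] at this
  linarith

lemma productDominated_pow_six {h : E3 → ℝ} (hc : Continuous h) (hh0 : ∀ x, 0 < h x) {C : ℝ}
    (hhC : ∀ x, h x ≤ C * W x) {c : ℝ} (h_c : 0 < c) :
    ProductDominated cauchyKernel fun x => c * h x ^ 6 where
  continuous := by fun_prop
  pos x := mul_pos h_c (pow_pos (hh0 x) 6)
  le := ⟨c * C ^ 6, fun x => by
    calc c * h x ^ 6 ≤ c * (C * W x) ^ 6 := by have := (hh0 x).le; have := hhC x; gcongr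
      _ = c * C ^ 6 * W x ^ 6 := by ring
      _ ≤ _ := by have := W_pow_six_le x; gcongr⟩

lemma three_mul_le_add_of_pow_three_eq {r x y z : ℝ} (hx : 0 < x) (hy : 0 < y)
    (hz : 0 < z) (h : r ^ 3 = x * y * z) : 3 * r ≤ x + y + z := by
  refine le_of_pow_le_pow_left₀ three_ne_zero (by positivity) ?_
  rw [mul_pow, h]
  nlinarith [mul_nonneg hx.le (sq_nonneg (y - z)), mul_nonneg hy.le (sq_nonneg (x - z)),
    mul_nonneg hz.le (sq_nonneg (x - y)),
    mul_nonneg (add_pos (add_pos hx hy) hz).le (add_nonneg (add_nonneg (sq_nonneg (x - y))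
      (sq_nonneg (y - z))) (sq_nonneg (x - z)))]

lemma exists_cube_root {A : ℝ} (hA : 0 < A) : ∃ a, 0 < a ∧ a ^ 3 = A :=
  ⟨A ^ (1 / 3 : ℝ), by positivity, by
    rw [← Real.rpow_natCast, ← Real.rpow_mul hA.le]; norm_num⟩

/-- The sharp Sobolev inequality for positive functions decaying like `W`. -/
theorem sobolev_of_le_W {h : E3 → ℝ} (hh : ContDiff ℝ 1 h) (hh0 : ∀ x, 0 < h x) {C : ℝ}
    (hhC : ∀ x, h x ≤ C * W x) (hg : Integrable (gradSqR h)) :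
    (∫ x, h x ^ 6) * (∫ x, gradSqR W x) ^ 3 ≤ (∫ x, W x ^ 6) * (∫ x, gradSqR h x) ^ 3 := by
  have hc := hh.continuous
  have hWC : ∀ x, W x ≤ 1 * W x := fun x => by simp
  have hA6 : Integrable fun x => h x ^ 6 := by
    simpa using (productDominated_pow_six hc hh0 hhC one_pos).integrable integrable_cauchyKernel
  have hB6 : Integrable fun x => W x ^ 6 := by
    simpa using (productDominated_pow_six continuous_W W_pos hWC one_pos).integrable
      integrable_cauchyKernel
  obtain ⟨a, ha, haA⟩ := exists_cube_root
    (integral_pos_of_forall_pos (fun x => pow_pos (hh0 x) 6) hA6)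
  obtain ⟨b, hb, hbB⟩ := exists_cube_root
    (integral_pos_of_forall_pos (fun x => pow_pos (W_pos x) 6) hB6)
  obtain ⟨T, D, hT, hD, hDm, hD0, hDG, hTFG⟩ := exists_knothe integrable_cauchyKernel
    cauchyKernel_nonneg cauchyKernel_le_one
    (productDominated_pow_six hc hh0 hhC (inv_pos.2 (pow_pos ha 3)))
    (productDominated_pow_six continuous_W W_pos hWC (inv_pos.2 (pow_pos hb 3)))
    (by rw [integral_const_mul, integral_const_mul, ← haA, ← hbB,
          inv_mul_cancel₀ (by positivity), inv_mul_cancel₀ (by positivity)])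
  have hFm : Measurable fun x => (a ^ 3)⁻¹ * h x ^ 6 := (hc.measurable.pow_const 6).const_mul _
  have hF0 : ∀ x, 0 ≤ (a ^ 3)⁻¹ * h x ^ 6 := fun x => by positivity
  have hG0 : ∀ x, 0 ≤ (b ^ 3)⁻¹ * W x ^ 6 := fun x => by positivity
  set E := ∫ x, gradSqR W x with hE
  set K := ∫ x, gradSqR h x with hK
  obtain ⟨hi2, he2⟩ := integral_comp_mul_of_lintegral hT hFm hF0 hG0 hTFG
    (ψ := fun y => ‖y‖ ^ 2) (by fun_prop) (fun y => by positivity) (by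
      refine (integrable_norm_sq_mul_W_pow_six.const_mul (b ^ 3)⁻¹).congr (ae_of_all _ fun y => ?_)
      ring)
  obtain ⟨hi4, he4⟩ := integral_comp_mul_of_lintegral hT hFm hF0 hG0 hTFG
    (ψ := fun y => 1 + ‖y‖ ^ 2 / 3) (by fun_prop) (fun y => by positivity) (by
      refine (integrable_W_pow_four.const_mul (b ^ 3)⁻¹).congr (ae_of_all _ fun y => ?_)
      simp only [← W_pow_six_mul]
      ring)
  have he2' : ∫ x, ‖T x‖ ^ 2 * ((a ^ 3)⁻¹ * h x ^ 6) = 9 * E / b ^ 3 := by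
    rw [he2, hE, ← integral_norm_sq_mul_W_pow_six, ← integral_div]
    congr 1 with y
    ring
  have he4' : ∫ x, (1 + ‖T x‖ ^ 2 / 3) * ((a ^ 3)⁻¹ * h x ^ 6) = 4 * E / b ^ 3 := by
    rw [he4, hE, ← integral_W_pow_four, ← integral_div]
    congr 1 with y
    rw [← W_pow_six_mul]
    ring
  have hw : ∀ i, Integrable fun x => T x i ^ 2 * h x ^ 6 := fun i => by
    refine (hi2.const_mul (a ^ 3)).mono' (Measurable.aestronglyMeasurable
      (by have := hc.measurable; fun_prop)) (ae_of_all _ fun x => ?_)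
    rw [Real.norm_of_nonneg (by positivity)]
    calc T x i ^ 2 * h x ^ 6 ≤ ‖T x‖ ^ 2 * h x ^ 6 := by
          have := apply_sq_le i (T x); gcongr
      _ = _ := by field_simp
  have hp := integrable_pdR_sq hh hg
  have hibp := fun i => integral_pow_four_mul hh hh0 hhC i (hp i) (hD i)
    (by fun_prop) (hDm i) (fun x => (hD0 i x).le) (hw i)
  have hlow : 12 * (a / b) ^ 2 * E ≤ ∑ i, ∫ x, h x ^ 4 * D i x := by
    rw [← integral_finsetSum _ fun i _ => (hibp i).2.1]
    have : 12 * (a / b) ^ 2 * E = 3 * a ^ 2 * b * (4 * E / b ^ 3) := by field_simp; ring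
    rw [this, ← he4', ← integral_const_mul]
    refine integral_mono (hi4.const_mul _) (integrable_finsetSum _ fun i _ => (hibp i).2.1)
      fun x => ?_
    have hWT := W_pos (T x)
    have hhx := hh0 x
    have h1 := three_mul_le_add_of_pow_three_eq (r := h x ^ 2 * b / (a * W (T x) ^ 2)) (hD0 0 x)
      (hD0 1 x) (hD0 2 x) (by
        have h2 : D 0 x * D 1 x * D 2 x * ((b ^ 3)⁻¹ * W (T x) ^ 6) = (a ^ 3)⁻¹ * h x ^ 6 := hDG x
        generalize D 0 x * D 1 x * D 2 x = p at h2 ⊢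
        field_simp at h2 ⊢
        linarith)
    have h3 : 1 + ‖T x‖ ^ 2 / 3 = 1 / W (T x) ^ 2 := by rw [W_sq]; simp
    simp only [Fin.sum_univ_three, h3]
    calc 3 * a ^ 2 * b * (1 / W (T x) ^ 2 * ((a ^ 3)⁻¹ * h x ^ 6))
        = h x ^ 4 * (3 * (h x ^ 2 * b / (a * W (T x) ^ 2))) := by field_simp
      _ ≤ h x ^ 4 * (D 0 x + D 1 x + D 2 x) := by gcongr
      _ = _ := by ring
  have hup : ∑ i, ∫ x, h x ^ 4 * D i x ≤ 6 * (a / b) * K + 6 * (a / b) ^ 2 * E := by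
    have hn : ∀ i, Integrable fun x => 6 * (a / b) * pdR i h x ^ 2
        + 2 * b / (3 * a) * (T x i ^ 2 * h x ^ 6) := fun i =>
      ((hp i).const_mul _).add ((hw i).const_mul _)
    calc ∑ i, ∫ x, h x ^ 4 * D i x
        ≤ ∑ i, ∫ x, (6 * (a / b) * pdR i h x ^ 2
            + 2 * b / (3 * a) * (T x i ^ 2 * h x ^ 6)) := by
          refine Finset.sum_le_sum fun i _ => ?_
          rw [(hibp i).2.2, ← integral_neg]
          refine integral_mono (hibp i).1.neg (hn i) fun x => ?_
          have h5 : 0 ≤ 2 * b / (3 * a) * (3 * (a / b) * pdR i h x + T x i * h x ^ 3) ^ 2 := by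
            positivity
          have h6 : 2 * b / (3 * a) * (3 * (a / b) * pdR i h x + T x i * h x ^ 3) ^ 2
              = 6 * (a / b) * pdR i h x ^ 2 + 2 * b / (3 * a) * (T x i ^ 2 * h x ^ 6)
                + 4 * h x ^ 3 * pdR i h x * T x i := by
            field_simp
            ring
          dsimp only
          linarith
      _ = ∫ x, (6 * (a / b) * gradSqR h x
            + 2 * b / (3 * a) * a ^ 3 * (‖T x‖ ^ 2 * ((a ^ 3)⁻¹ * h x ^ 6))) := by
          rw [← integral_finsetSum _ fun i _ => hn i]
          congr 1 with x
          simp only [Fin.sum_univ_three, gradSqR, norm_sq_eq]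
          field_simp
          ring
      _ = 6 * (a / b) * K + 2 * b / (3 * a) * a ^ 3 * (9 * E / b ^ 3) := by
          rw [integral_add (hg.const_mul _) (hi2.const_mul _), integral_const_mul,
            integral_const_mul, he2']
      _ = _ := by field_simp; ring
  have hEpos : 0 < E := integral_gradSqR_W_pos
  have hfin : a * E ≤ b * K := by
    have h7 : 6 * (a / b) * ((a / b) * E) ≤ 6 * (a / b) * K := by nlinarith
    have h8 := le_of_mul_le_mul_left h7 (by positivity)
    rw [div_mul_eq_mul_div, div_le_iff₀ hb] at h8
    linarith
  rw [← haA, ← hbB, ← mul_pow, ← mul_pow]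
  gcongr

lemma gradSqR_nonneg (f : E3 → ℝ) (x : E3) : 0 ≤ gradSqR f x :=
  Finset.sum_nonneg fun _ _ => sq_nonneg _

lemma gradSqC_nonneg (f : E3 → ℂ) (x : E3) : 0 ≤ gradSqC f x :=
  Finset.sum_nonneg fun _ _ => sq_nonneg _

lemma continuous_gradSqR {f : E3 → ℝ} (hf : ContDiff ℝ 1 f) : Continuous (gradSqR f) :=
  continuous_finsetSum _ fun i _ => (continuous_pdR hf i).pow 2

lemma continuous_gradSqC {f : E3 → ℂ} (hf : ContDiff ℝ 1 f) : Continuous (gradSqC f) :=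
  continuous_finsetSum _ fun _ _ =>
    (((hf.continuous_fderiv one_ne_zero).clm_apply continuous_const).norm).pow 2

lemma hasCompactSupport_gradSqR {f : E3 → ℝ} (hf : HasCompactSupport f) :
    HasCompactSupport (gradSqR f) :=
  (hf.fderiv (𝕜 := ℝ)).comp_left (g := fun L : E3 →L[ℝ] ℝ => ∑ i, L (e3 i) ^ 2) (by simp)

lemma hasCompactSupport_gradSqC {f : E3 → ℂ} (hf : HasCompactSupport f) :
    HasCompactSupport (gradSqC f) :=
  (hf.fderiv (𝕜 := ℝ)).comp_left (g := fun L : E3 →L[ℝ] ℂ => ∑ i, ‖L (e3 i)‖ ^ 2) (by simp)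

lemma sq_mul_add_le (a b c d : ℝ) {m p : ℝ} (hm : |m| ≤ a * c) (hp : p = b * d) :
    (m + p) ^ 2 ≤ (a ^ 2 + b ^ 2) * (c ^ 2 + d ^ 2) := by
  have h1 : |m + p| ≤ |a| * |c| + |b| * |d| := by
    calc |m + p| ≤ |m| + |p| := abs_add_le _ _
      _ ≤ _ := by
        rw [hp, abs_mul, ← abs_mul a]
        have := hm.trans (le_abs_self _)
        gcongr
  calc (m + p) ^ 2 = |m + p| ^ 2 := (sq_abs _).symm
    _ ≤ (|a| * |c| + |b| * |d|) ^ 2 := by gcongr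
    _ ≤ (|a| ^ 2 + |b| ^ 2) * (|c| ^ 2 + |d| ^ 2) := by
      nlinarith [sq_nonneg (|a| * |d| - |b| * |c|)]
    _ = _ := by simp only [sq_abs]

lemma sqrt_regularization {g : E3 → ℂ} (hg : ContDiff ℝ 1 g) {ε : ℝ} (hε : 0 < ε) :
    ContDiff ℝ 1 (fun x => √(‖g x‖ ^ 2 + ε ^ 2 * W x ^ 2)) ∧
      ∀ x, gradSqR (fun x => √(‖g x‖ ^ 2 + ε ^ 2 * W x ^ 2)) x
        ≤ gradSqC g x + ε ^ 2 * gradSqR W x := by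
  have hpos : ∀ x, 0 < ‖g x‖ ^ 2 + ε ^ 2 * W x ^ 2 := fun x => by have := W_pos x; positivity
  have hC : ContDiff ℝ 1 (fun x => √(‖g x‖ ^ 2 + ε ^ 2 * W x ^ 2)) :=
    ((hg.norm_sq ℝ).add (contDiff_const.mul (contDiff_W.pow 2))).sqrt fun x => (hpos x).ne'
  refine ⟨hC, fun x => ?_⟩
  set h := fun x => √(‖g x‖ ^ 2 + ε ^ 2 * W x ^ 2) with hh
  have hsq : ∀ x, h x ^ 2 = ‖g x‖ ^ 2 + ε ^ 2 * W x ^ 2 := fun x => Real.sq_sqrt (hpos x).le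
  simp only [gradSqR, gradSqC, Finset.mul_sum, ← Finset.sum_add_distrib]
  refine Finset.sum_le_sum fun i _ => ?_
  have hd := (hC.differentiable one_ne_zero x).hasFDerivAt.hasLineDerivAt (e3 i)
  have hdg := ((hg.differentiable one_ne_zero x).hasFDerivAt.norm_sq).hasLineDerivAt (e3 i)
  have hdW := hasLineDerivAt_of_contDiff contDiff_W i x
  have e1 := HasDerivAt.pow hd 2
  have e2 := HasDerivAt.add hdg ((HasDerivAt.pow hdW 2).const_mul (ε ^ 2))
  have e3' : h x * pdR i h x = inner ℝ (g x) (pdC i g x) + ε ^ 2 * W x * pdR i W x := by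
    have := e1.unique (e2.congr_of_eventuallyEq (Eventually.of_forall fun t => ?_))
    · simp at this
      simp only [pdC, pdR, Complex.inner, mul_re, conj_re, conj_im] at this ⊢
      linarith
    · simp [hsq]
  have h4 : h x ^ 2 * pdR i h x ^ 2 ≤ h x ^ 2 * (‖pdC i g x‖ ^ 2 + ε ^ 2 * pdR i W x ^ 2) := by
    rw [← mul_pow, e3', hsq, ← mul_pow, ← mul_pow]
    exact sq_mul_add_le _ _ _ _ (abs_real_inner_le_norm _ _) (by ring)
  exact le_of_mul_le_mul_left h4 (by rw [hsq]; exact hpos x)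

/-- The sharp Sobolev inequality for compactly supported complex-valued functions. -/
theorem sobolev_of_hasCompactSupport {g : E3 → ℂ} (hg : ContDiff ℝ 1 g)
    (hs : HasCompactSupport g) :
    (∫ x, ‖g x‖ ^ 6) * (∫ x, gradSqR W x) ^ 3
      ≤ (∫ x, W x ^ 6) * (∫ x, gradSqC g x) ^ 3 := by
  have hgi : Integrable (gradSqC g) :=
    (continuous_gradSqC hg).integrable_of_hasCompactSupport (hasCompactSupport_gradSqC hs)
  have hE := integral_gradSqR_W_pos
  have hB : 0 ≤ ∫ x, W x ^ 6 := integral_nonneg fun x => pow_nonneg (W_pos x).le 6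
  have hK : 0 ≤ ∫ x, gradSqC g x := integral_nonneg fun x => gradSqC_nonneg g x
  obtain ⟨M, hM⟩ : ∃ M, ∀ x, ‖(W x)⁻¹ • g x‖ ≤ M :=
    ((continuous_W.inv₀ fun x => (W_pos x).ne').smul hg.continuous).bounded_above_of_compact_support
      hs.smul_left
  have hgM : ∀ x, ‖g x‖ ≤ M * W x := fun x => by
    have h1 := hM x
    have := W_pos x
    rwa [norm_smul, Real.norm_of_nonneg (by positivity), inv_mul_le_iff₀ this, mul_comm] at h1
  have key : ∀ ε : ℝ, 0 < ε → (∫ x, ‖g x‖ ^ 6) * (∫ x, gradSqR W x) ^ 3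
      ≤ (∫ x, W x ^ 6) * ((∫ x, gradSqC g x) + ε ^ 2 * ∫ x, gradSqR W x) ^ 3 := by
    intro ε hε
    obtain ⟨hC, hgrad⟩ := sqrt_regularization hg hε
    have hpos : ∀ x, 0 < ‖g x‖ ^ 2 + ε ^ 2 * W x ^ 2 := fun x => by have := W_pos x; positivity
    set h := fun x => √(‖g x‖ ^ 2 + ε ^ 2 * W x ^ 2) with hh
    have hi : Integrable fun x => gradSqC g x + ε ^ 2 * gradSqR W x :=
      hgi.add (integrable_gradSqR_W.const_mul _)
    have hgh : Integrable (gradSqR h) := by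
      refine hi.mono' (continuous_gradSqR hC).aestronglyMeasurable (ae_of_all _ fun x => ?_)
      rw [Real.norm_of_nonneg (gradSqR_nonneg h x)]
      exact hgrad x
    have hh0 : ∀ x, 0 < h x := fun x => Real.sqrt_pos.2 (hpos x)
    have hhW : ∀ x, h x ≤ √(M ^ 2 + ε ^ 2) * W x := fun x => by
      have := W_pos x
      have := hgM x
      refine Real.sqrt_le_iff.2 ⟨by positivity, ?_⟩
      rw [mul_pow, Real.sq_sqrt (by positivity), add_mul, ← mul_pow M]
      gcongr
    have h6 : Integrable fun x => h x ^ 6 := by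
      simpa using (productDominated_pow_six hC.continuous hh0 hhW one_pos).integrable
        integrable_cauchyKernel
    calc (∫ x, ‖g x‖ ^ 6) * (∫ x, gradSqR W x) ^ 3
        ≤ (∫ x, h x ^ 6) * (∫ x, gradSqR W x) ^ 3 := by
          refine mul_le_mul_of_nonneg_right ?_ (by positivity)
          refine integral_mono_of_nonneg (ae_of_all _ fun x => by positivity) h6
            (ae_of_all _ fun x => ?_)
          refine pow_le_pow_left₀ (norm_nonneg _) (Real.le_sqrt_of_sq_le ?_) 6
          have := W_pos x
          have : 0 ≤ ε ^ 2 * W x ^ 2 := by positivity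
          linarith
      _ ≤ (∫ x, W x ^ 6) * (∫ x, gradSqR h x) ^ 3 := sobolev_of_le_W hC hh0 hhW hgh
      _ ≤ _ := by
          refine mul_le_mul_of_nonneg_left (pow_le_pow_left₀
            (integral_nonneg fun x => gradSqR_nonneg h x) ?_ 3) hB
          rw [← integral_const_mul, ← integral_add hgi (integrable_gradSqR_W.const_mul _)]
          exact integral_mono hgh hi hgrad
  have ht : Tendsto (fun ε : ℝ => (∫ x, W x ^ 6) *
      ((∫ x, gradSqC g x) + ε ^ 2 * ∫ x, gradSqR W x) ^ 3) (𝓝[>] 0)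
      (𝓝 ((∫ x, W x ^ 6) * ((∫ x, gradSqC g x) + 0 ^ 2 * ∫ x, gradSqR W x) ^ 3)) :=
    (Continuous.tendsto (by fun_prop) 0).mono_left nhdsWithin_le_nhds
  have := ge_of_tendsto ht (eventually_mem_nhdsWithin.mono fun ε hε => key ε hε)
  simpa using this

/-- Rescaled smooth cutoffs exhausting `ℝ³`. -/
def cutoff (χ : ContDiffBump (0 : E3)) (n : ℕ) (x : E3) : ℝ := χ ((n + 1 : ℝ)⁻¹ • x)

section Cutoff

variable (χ : ContDiffBump (0 : E3)) (n : ℕ)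

lemma contDiff_cutoff : ContDiff ℝ 1 (cutoff χ n) :=
  χ.contDiff.comp (contDiff_const_smul _)

lemma hasCompactSupport_cutoff : HasCompactSupport (cutoff χ n) :=
  χ.hasCompactSupport.comp_smul (by positivity)

lemma eventually_cutoff_eq_one (x : E3) : ∀ᶠ n in atTop, cutoff χ n x = 1 := by
  have h : Tendsto (fun n : ℕ => ((n : ℝ) + 1)⁻¹ • x) atTop (𝓝 ((0 : ℝ) • x)) :=
    (tendsto_inv_atTop_zero.comp
      (tendsto_atTop_add_const_right _ _ tendsto_natCast_atTop_atTop)).smul_const x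
  rw [zero_smul] at h
  exact (h.eventually (Metric.closedBall_mem_nhds _ χ.rIn_pos)).mono
    fun n hn => χ.one_of_mem_closedBall hn

lemma gradSqR_cutoff (x : E3) :
    gradSqR (cutoff χ n) x = ((n + 1 : ℝ)⁻¹) ^ 2 * gradSqR χ ((n + 1 : ℝ)⁻¹ • x) := by
  have h : fderiv ℝ (cutoff χ n) x = (n + 1 : ℝ)⁻¹ • fderiv ℝ χ ((n + 1 : ℝ)⁻¹ • x) := by
    unfold cutoff
    exact fderiv_comp_smul _
  simp only [gradSqR, pdR, h, Finset.mul_sum, smul_apply, smul_eq_mul, mul_pow]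

lemma gradSqR_bump_of_norm_lt {χ : ContDiffBump (0 : E3)} {x : E3} (hx : ‖x‖ < χ.rIn) :
    gradSqR χ x = 0 := by
  have h : fderiv ℝ χ x = 0 := by
    rw [(χ.eventuallyEq_one_of_mem_ball (by simpa using hx)).fderiv_eq]
    simp
  simp [gradSqR, pdR, h]

end Cutoff

lemma sq_mul_sq_le {x y L : ℝ} (hy : 0 ≤ y) (hL : 0 < L) :
    x ^ 2 * y ^ 2 ≤ x ^ 6 / L ^ 2 + L * y ^ 3 := by
  rcases le_total (L * y) (x ^ 2) with h | h
  · have h1 : (L * y) ^ 2 ≤ (x ^ 2) ^ 2 := by gcongr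
    have h2 : x ^ 2 * y ^ 2 ≤ x ^ 6 / L ^ 2 := by
      rw [le_div_iff₀ (by positivity)]
      nlinarith [sq_nonneg x]
    have : 0 ≤ L * y ^ 3 := by positivity
    linarith
  · have h2 : x ^ 2 * y ^ 2 ≤ L * y * y ^ 2 := by gcongr
    have : 0 ≤ x ^ 6 / L ^ 2 := by positivity
    nlinarith

lemma tendsto_integral_indicator_outside {u : E3 → ℝ} (hu0 : ∀ x, 0 ≤ u x) (hi : Integrable u)
    {r : ℝ} (hr : 0 < r) :
    Tendsto (fun n : ℕ => ∫ x, {y | r ≤ ‖((n : ℝ) + 1)⁻¹ • y‖}.indicator u x) atTop (𝓝 0) := by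
  have hS : ∀ n : ℕ, MeasurableSet {y : E3 | r ≤ ‖((n : ℝ) + 1)⁻¹ • y‖} := fun n =>
    (isClosed_le continuous_const (by fun_prop)).measurableSet
  rw [show (0 : ℝ) = ∫ _ : E3, (0 : ℝ) by simp]
  refine tendsto_integral_of_dominated_convergence u
    (fun n => (hi.indicator (hS n)).aestronglyMeasurable) hi
    (fun n => ae_of_all _ fun x => (norm_indicator_le_norm_self _ _).trans_eq
      (Real.norm_of_nonneg (hu0 x))) (ae_of_all _ fun x => ?_)
  have h : Tendsto (fun n : ℕ => ‖((n : ℝ) + 1)⁻¹ • x‖) atTop (𝓝 ‖(0 : ℝ) • x‖) :=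
    ((tendsto_inv_atTop_zero.comp (tendsto_atTop_add_const_right _ _
      tendsto_natCast_atTop_atTop)).smul_const x).norm
  rw [zero_smul, norm_zero] at h
  refine tendsto_const_nhds.congr' ((h.eventually_lt_const hr).mono fun n hn => ?_)
  exact (indicator_of_notMem (s := {y : E3 | r ≤ ‖((n : ℝ) + 1)⁻¹ • y‖})
    (fun hx => absurd hn (not_lt.2 hx)) u).symm

lemma exists_integral_sq_mul_gradSqR_cutoff_le (χ : ContDiffBump (0 : E3)) :
    ∃ P : ℝ, 0 ≤ P ∧ ∀ u : E3 → ℝ, (Integrable fun x => u x ^ 6) → ∀ L : ℝ, 0 < L → ∀ n : ℕ,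
      ∫ x, u x ^ 2 * gradSqR (cutoff χ n) x
        ≤ (∫ x, {y | χ.rIn ≤ ‖((n : ℝ) + 1)⁻¹ • y‖}.indicator (fun x => u x ^ 6) x) / L ^ 2
          + L * P := by
  have hχ : ContDiff ℝ 1 χ := χ.contDiff
  obtain ⟨q, hqc, hqs, hq0, hq⟩ : ∃ q : E3 → ℝ, Continuous q ∧ HasCompactSupport q ∧
      (∀ x, 0 ≤ q x) ∧ ∀ x, gradSqR χ x = q x ^ 2 :=
    ⟨fun x => √(gradSqR χ x), (continuous_gradSqR hχ).sqrt,
      (hasCompactSupport_gradSqR χ.hasCompactSupport).comp_left (g := Real.sqrt) Real.sqrt_zero,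
      fun x => Real.sqrt_nonneg _, fun x => (Real.sq_sqrt (gradSqR_nonneg _ _)).symm⟩
  have hqs3 : HasCompactSupport fun x => q x ^ 3 := by
    refine hqs.mono fun x hx => ?_
    rw [Function.mem_support] at hx ⊢
    exact ne_zero_pow three_ne_zero hx
  have hqi : Integrable fun x => q x ^ 3 :=
    Continuous.integrable_of_hasCompactSupport (by fun_prop) hqs3
  refine ⟨∫ x, q x ^ 3, integral_nonneg fun x => pow_nonneg (hq0 x) 3, fun u hi L hL n => ?_⟩
  have hS : MeasurableSet {y : E3 | χ.rIn ≤ ‖((n : ℝ) + 1)⁻¹ • y‖} :=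
    (isClosed_le continuous_const (by fun_prop)).measurableSet
  have hgrad := gradSqR_cutoff χ n
  have hRpos : 0 < ((n : ℝ) + 1)⁻¹ := by positivity
  generalize ((n : ℝ) + 1)⁻¹ = R at *
  have hqR : Integrable fun x => (R * q (R • x)) ^ 3 := by
    simp only [mul_pow]
    exact (hqi.comp_smul hRpos.ne').const_mul _
  have hqP : ∫ x, (R * q (R • x)) ^ 3 = ∫ x, q x ^ 3 := by
    simp only [mul_pow]
    rw [integral_const_mul, Measure.integral_comp_smul volume (fun x => q x ^ 3)]
    simp only [finrank_euclideanSpace, Fintype.card_fin, smul_eq_mul]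
    rw [abs_of_pos (by positivity), mul_inv_cancel_left₀ (by positivity)]
  rw [← hqP, ← integral_div, ← integral_const_mul, ← integral_add
    ((hi.indicator hS).div_const _) (hqR.const_mul _)]
  refine integral_mono_of_nonneg
    (ae_of_all _ fun x => mul_nonneg (sq_nonneg _) (gradSqR_nonneg _ _))
    (((hi.indicator hS).div_const _).add (hqR.const_mul _)) (ae_of_all _ fun x => ?_)
  have hqx : gradSqR (cutoff χ n) x = (R * q (R • x)) ^ 2 := by rw [hgrad, mul_pow, hq]
  have hRq : 0 ≤ R * q (R • x) := mul_nonneg hRpos.le (hq0 _)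
  by_cases hx : x ∈ {y : E3 | χ.rIn ≤ ‖R • y‖}
  · simp only [indicator_of_mem hx, hqx]
    exact sq_mul_sq_le hRq hL
  · have h0 : gradSqR (cutoff χ n) x = 0 := by
      rw [hgrad, gradSqR_bump_of_norm_lt (not_le.1 hx), mul_zero]
    simp only [h0, indicator_of_notMem hx, mul_zero, zero_div, zero_add]
    exact mul_nonneg hL.le (pow_nonneg hRq 3)

lemma tendsto_integral_sq_mul_gradSqR_cutoff (χ : ContDiffBump (0 : E3)) {u : E3 → ℝ}
    (hi : Integrable fun x => u x ^ 6) :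
    Tendsto (fun n => ∫ x, u x ^ 2 * gradSqR (cutoff χ n) x) atTop (𝓝 0) := by
  obtain ⟨P, hP, hle⟩ := exists_integral_sq_mul_gradSqR_cutoff_le χ
  have htail := tendsto_integral_indicator_outside (fun x => by positivity) hi χ.rIn_pos
  refine tendsto_order.2 ⟨fun η hη => Eventually.of_forall fun n => hη.trans_le
    (integral_nonneg fun x => mul_nonneg (sq_nonneg _) (gradSqR_nonneg _ _)), fun η hη => ?_⟩
  have hL : 0 < η / (2 * (P + 1)) := by positivity
  have h1 : η / (2 * (P + 1)) * P < η / 2 := by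
    rw [div_mul_eq_mul_div, div_lt_div_iff₀ (by positivity) (by positivity)]
    nlinarith
  generalize η / (2 * (P + 1)) = L at *
  have h2 := (htail.div_const (L ^ 2)).eventually_lt_const
    (show 0 / L ^ 2 < η / 2 by simpa using hη)
  refine h2.mono fun n hn => (hle u hi L hL n).trans_lt ?_
  linarith

lemma gradSqC_smul_le {χ : E3 → ℝ} {f : E3 → ℂ} (hχ : ContDiff ℝ 1 χ) (hf : ContDiff ℝ 1 f)
    {δ : ℝ} (hδ : 0 < δ) {x : E3} (hx : |χ x| ≤ 1) :
    gradSqC (fun x => χ x • f x) x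
      ≤ (1 + δ) * gradSqC f x + (1 + δ⁻¹) * (‖f x‖ ^ 2 * gradSqR χ x) := by
  simp only [gradSqR, gradSqC, Finset.mul_sum, ← Finset.sum_add_distrib]
  refine Finset.sum_le_sum fun i _ => ?_
  have hd : pdC i (fun x => χ x • f x) x = χ x • pdC i f x + pdR i χ x • f x := by
    have := ((hχ.differentiable one_ne_zero x).hasFDerivAt.smul
      (hf.differentiable one_ne_zero x).hasFDerivAt).fderiv
    unfold pdC pdR
    erw [this]
    simp
  have h1 : ‖pdC i (fun x => χ x • f x) x‖ ≤ ‖pdC i f x‖ + |pdR i χ x| * ‖f x‖ := by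
    rw [hd]
    refine (norm_add_le _ _).trans ?_
    rw [norm_smul, norm_smul, Real.norm_eq_abs, Real.norm_eq_abs]
    have := mul_le_mul_of_nonneg_right hx (norm_nonneg (pdC i f x))
    linarith
  calc ‖pdC i (fun x => χ x • f x) x‖ ^ 2 ≤ (‖pdC i f x‖ + |pdR i χ x| * ‖f x‖) ^ 2 := by gcongr
    _ ≤ (1 + δ) * ‖pdC i f x‖ ^ 2 + (1 + δ⁻¹) * (|pdR i χ x| * ‖f x‖) ^ 2 := by
      have h2 : 0 ≤ δ⁻¹ * (δ * ‖pdC i f x‖ - |pdR i χ x| * ‖f x‖) ^ 2 := by positivity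
      have h3 : δ⁻¹ * (δ * ‖pdC i f x‖ - |pdR i χ x| * ‖f x‖) ^ 2
          = δ * ‖pdC i f x‖ ^ 2 - 2 * ‖pdC i f x‖ * (|pdR i χ x| * ‖f x‖)
            + δ⁻¹ * (|pdR i χ x| * ‖f x‖) ^ 2 := by
        field_simp
        ring
      linarith
    _ = _ := by
      rw [mul_pow, sq_abs]
      ring

/-- The sharp Sobolev inequality for `C¹` functions in `L⁶` with gradient in `L²`. -/
theorem sobolev_inequality {f : E3 → ℂ} (hf : ContDiff ℝ 1 f)
    (hi : Integrable fun x => ‖f x‖ ^ 6) (hg : Integrable (gradSqC f)) :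
    (∫ x, ‖f x‖ ^ 6) * (∫ x, gradSqR W x) ^ 3
      ≤ (∫ x, W x ^ 6) * (∫ x, gradSqC f x) ^ 3 := by
  let χ : ContDiffBump (0 : E3) := default
  have hB : 0 ≤ ∫ x, W x ^ 6 := integral_nonneg fun x => pow_nonneg (W_pos x).le 6
  have hχ1 : ∀ n x, |cutoff χ n x| ≤ 1 := fun n x => by
    rw [cutoff, abs_of_nonneg χ.nonneg]
    exact χ.le_one
  have hJ := tendsto_integral_sq_mul_gradSqR_cutoff χ hi
  have hA : Tendsto (fun n => ∫ x, ‖cutoff χ n x • f x‖ ^ 6) atTop (𝓝 (∫ x, ‖f x‖ ^ 6)) := by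
    refine tendsto_integral_of_dominated_convergence (fun x => ‖f x‖ ^ 6) (fun n =>
      ((((contDiff_cutoff χ n).continuous.smul hf.continuous).norm).pow 6).aestronglyMeasurable)
      hi (fun n => ae_of_all _ fun x => ?_) (ae_of_all _ fun x => ?_)
    · rw [Real.norm_of_nonneg (by positivity), norm_smul]
      gcongr
      exact mul_le_of_le_one_left (norm_nonneg _) (hχ1 n x)
    · refine tendsto_const_nhds.congr' ((eventually_cutoff_eq_one χ x).mono fun n hn => ?_)
      simp [hn]
  have key : ∀ δ : ℝ, 0 < δ → (∫ x, ‖f x‖ ^ 6) * (∫ x, gradSqR W x) ^ 3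
      ≤ (∫ x, W x ^ 6) * ((1 + δ) * ∫ x, gradSqC f x) ^ 3 := by
    intro δ hδ
    have hn : ∀ n, (∫ x, ‖cutoff χ n x • f x‖ ^ 6) * (∫ x, gradSqR W x) ^ 3
        ≤ (∫ x, W x ^ 6) * ((1 + δ) * (∫ x, gradSqC f x)
          + (1 + δ⁻¹) * ∫ x, ‖f x‖ ^ 2 * gradSqR (cutoff χ n) x) ^ 3 := by
      intro n
      have hCn := contDiff_cutoff χ n
      have hsn := hasCompactSupport_cutoff χ n
      have hJi : Integrable fun x => ‖f x‖ ^ 2 * gradSqR (cutoff χ n) x :=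
        ((hf.continuous.norm.pow 2).mul (continuous_gradSqR hCn)).integrable_of_hasCompactSupport
          (hasCompactSupport_gradSqR hsn).mul_left
      refine (sobolev_of_hasCompactSupport (hCn.smul hf) hsn.smul_right).trans ?_
      refine mul_le_mul_of_nonneg_left (pow_le_pow_left₀
        (integral_nonneg fun x => gradSqC_nonneg _ x) ?_ 3) hB
      rw [← integral_const_mul, ← integral_const_mul,
        ← integral_add (hg.const_mul _) (hJi.const_mul _)]
      exact integral_mono_of_nonneg (ae_of_all _ fun x => gradSqC_nonneg _ x)
        ((hg.const_mul _).add (hJi.const_mul _))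
        (ae_of_all _ fun x => gradSqC_smul_le hCn hf hδ (hχ1 n x))
    have h2 := le_of_tendsto_of_tendsto' (hA.mul_const _)
      ((((hJ.const_mul (1 + δ⁻¹)).const_add _).pow 3).const_mul _) hn
    simpa using h2
  have ht : Tendsto (fun δ : ℝ => (∫ x, W x ^ 6) * ((1 + δ) * ∫ x, gradSqC f x) ^ 3) (𝓝[>] 0)
      (𝓝 ((∫ x, W x ^ 6) * ((1 + 0) * ∫ x, gradSqC f x) ^ 3)) :=
    (Continuous.tendsto (by fun_prop) 0).mono_left nhdsWithin_le_nhds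
  have := ge_of_tendsto ht (eventually_mem_nhdsWithin.mono fun δ hδ => key δ hδ)
  simpa using this

lemma norm_Wc (x : E3) : ‖Wc x‖ = W x := by
  rw [Wc, Complex.norm_real, Real.norm_of_nonneg (W_pos x).le]

lemma contDiff_Wc : ContDiff ℝ 1 Wc := Complex.ofRealCLM.contDiff.comp contDiff_W

lemma gradSqC_Wc : gradSqC Wc = gradSqR W := by
  ext x
  have h : fderiv ℝ Wc x = Complex.ofRealCLM.comp (fderiv ℝ W x) :=
    (Complex.ofRealCLM.hasFDerivAt.comp x
      (contDiff_W.differentiable one_ne_zero x).hasFDerivAt).fderiv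
  simp [gradSqC, gradSqR, pdC, pdR, h, Complex.norm_real]

lemma integrable_W_pow_six : Integrable fun x => W x ^ 6 := by
  simpa using (productDominated_pow_six continuous_W W_pos (C := 1) (fun x => by simp)
    one_pos).integrable integrable_cauchyKernel

lemma Ecrit_eq {f : E3 → ℂ} (hi : Integrable fun x => ‖f x‖ ^ 6) (hg : Integrable (gradSqC f)) :
    Ecrit f = 1 / 2 * (∫ x, gradSqC f x) - 1 / 6 * ∫ x, ‖f x‖ ^ 6 := by
  unfold Ecrit
  rw [integral_sub (hg.const_mul _) (hi.const_mul _), integral_const_mul, integral_const_mul]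

end

/-- Variational characterization: `E^c(W)` is the least critical energy among
`C¹` functions with `f ∈ L⁶`, `∇f ∈ L²` and `‖∇f‖_{L²} = ‖∇W‖_{L²}`;
the infimum is attained at `W`. -/
theorem ground_state_variational :
    IsLeast { Energy : ℝ | ∃ f : E3 → ℂ, ContDiff ℝ 1 f ∧
        Integrable (fun x : E3 => ‖f x‖ ^ 6) ∧ Integrable (gradSqC f) ∧
        (∫ x : E3, gradSqC f x) = (∫ x : E3, gradSqR W x) ∧
        Energy = Ecrit f }
      (Ecrit Wc) := by
  have hW6 : Integrable fun x => ‖Wc x‖ ^ 6 := by simpa only [norm_Wc] using integrable_W_pow_six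
  have hWg : Integrable (gradSqC Wc) := by rw [gradSqC_Wc]; exact integrable_gradSqR_W
  constructor
  · exact ⟨Wc, contDiff_Wc, hW6, hWg, by rw [gradSqC_Wc], rfl⟩
  · rintro _ ⟨f, hf, hi, hg, hfW, rfl⟩
    have h := sobolev_inequality hf hi hg
    rw [hfW] at h
    have h2 := le_of_mul_le_mul_right h (pow_pos integral_gradSqR_W_pos 3)
    rw [Ecrit_eq hW6 hWg, Ecrit_eq hi hg, hfW, gradSqC_Wc]
    simp only [norm_Wc]
    linarith
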